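/- arXiv:2303.16348 — 6 statements merged into one kernel-verified Lean document; each statement's English description precedes it below -/
import Mathlib

section
/- Let A ⊆ G with |A| = δN, δ > 0, let ε > 0, ε_* = min{ε,1}, and η ∈ (0, 1/2) be parameters. Suppose k, l ≥ 2 are integers with kl ≥ 4·ε_*^{-1}·L(η) and E^k_l(1_A) ≥ (1+ε)^{lk} δ^{lk} N^{l+k}. Define S = { x ∈ G^l : C_l(1_A)(x) ≥ (1+ε/4)^l δ^l N }. Then there exists a set B ⊆ G with |B| > 2^{-1/(l−1)} (1+ε)^k δ^k N such that N^{-1} · Σ_{x∈S} C_l(1_B)(x) ≥ (1 − 2η) |B|^l. -/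
open scoped BigOperators

attribute [local instance] Classical.propDecidable

noncomputable section

/-- The generalized convolution `C_l(f)(x) = Σ_z f(z+x_1)⋯f(z+x_l)`. -/
def conv (G : Type*) [AddCommGroup G] [Fintype G] (l : ℕ) (f : G → ℝ) (x : Fin l → G) : ℝ :=
  ∑ z : G, ∏ i : Fin l, f (z + x i)

/-- The higher energy `E^k_l(f) = Σ_{x ∈ G^l} C_l(f)(x)^k`. -/
def energy (G : Type*) [AddCommGroup G] [Fintype G] (k l : ℕ) (f : G → ℝ) : ℝ :=
  ∑ x : Fin l → G, conv G l f x ^ k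

/-- Indicator function of a finite set, real valued. -/
def ind {G : Type*} (A : Finset G) : G → ℝ := fun x => if x ∈ A then 1 else 0

/-- The balanced function `f_A = 1_A − |A|/N`. -/
def bal {G : Type*} [Fintype G] (A : Finset G) : G → ℝ := fun x =>
  ind A x - (A.card : ℝ) / (Fintype.card G : ℝ)

/-- `A` is `ε`-uniform relatively to `E^k_l`:  `E^k_l(f_A) ≤ ε^{kl} δ^{kl} N^{k+l}`
where `δ = |A|/N`. -/
def unif (G : Type*) [AddCommGroup G] [Fintype G] (ε : ℝ) (k l : ℕ) (A : Finset G) : Prop :=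
  energy G k l (bal A) ≤
    ε ^ (k * l) * ((A.card : ℝ) / (Fintype.card G : ℝ)) ^ (k * l) * (Fintype.card G : ℝ) ^ (k + l)

/-- `L(t) = log₂ (2/t)`. -/
def Lg (t : ℝ) : ℝ := Real.logb 2 (2 / t)

/-- `(f ∘ g)(x) = Σ_y f(y) g(y+x)`. -/
def circ {G : Type*} [AddCommGroup G] [Fintype G] (f g : G → ℝ) (x : G) : ℝ :=
  ∑ y : G, f y * g (y + x)

/-- `(f ∗ g)(x) = Σ_y f(y) g(x−y)`. -/
def convol {G : Type*} [AddCommGroup G] [Fintype G] (f g : G → ℝ) (x : G) : ℝ :=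
  ∑ y : G, f y * g (x - y)

lemma sum_conv {G : Type*} [AddCommGroup G] [Fintype G] (l : ℕ) (f : G → ℝ) :
    ∑ x : Fin l → G, conv G l f x = (Fintype.card G : ℝ) * (∑ z, f z) ^ l := by
  unfold conv
  rw [Finset.sum_comm]
  have h (z : G) : ∑ x : Fin l → G, ∏ i, f (z + x i) = (∑ z, f z) ^ l := by
    rw [← Fintype.sum_pow (fun g => f (z + g))]
    congr 1
    exact Equiv.sum_comp (Equiv.addLeft z) f
  simp [h]

lemma sum_conv_prod_translates {G : Type*} [AddCommGroup G] [Fintype G] (k l : ℕ) (f : G → ℝ)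
    (x : Fin l → G) :
    ∑ s : Fin k → G, conv G l (fun z => ∏ j, f (z + s j)) x =
      (Fintype.card G : ℝ) * conv G l f x ^ k := by
  unfold conv
  rw [Finset.sum_comm]
  have h (z : G) : ∑ s : Fin k → G, ∏ i, ∏ j, f (z + x i + s j) =
      (∑ z, ∏ i, f (z + x i)) ^ k := by
    simp_rw [Finset.prod_comm (s := (Finset.univ : Finset (Fin l)))]
    rw [← Fintype.sum_pow (fun g => ∏ i, f (z + x i + g))]
    congr 1
    rw [← Equiv.sum_comp (Equiv.addLeft z) (fun g => ∏ i, f (g + x i))]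
    simp only [Equiv.coe_addLeft, add_right_comm]
  simp [h]

lemma ind_nonneg {G : Type*} (A : Finset G) (z : G) : 0 ≤ ind A z := by
  unfold ind; split_ifs <;> norm_num

lemma sum_ind {G : Type*} [Fintype G] (A : Finset G) : ∑ z, ind A z = (A.card : ℝ) := by
  simp [ind]

lemma conv_ind_nonneg {G : Type*} [AddCommGroup G] [Fintype G] (l : ℕ) (A : Finset G)
    (x : Fin l → G) : 0 ≤ conv G l (ind A) x :=
  Finset.sum_nonneg fun _ _ => Finset.prod_nonneg fun _ _ => ind_nonneg _ _

/-- The intersection of the translates `A - s j`. -/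
def translateInter {G : Type*} [AddCommGroup G] [Fintype G] {k : ℕ} (A : Finset G)
    (s : Fin k → G) : Finset G :=
  Finset.univ.filter fun z => ∀ j, z + s j ∈ A

lemma ind_translateInter {G : Type*} [AddCommGroup G] [Fintype G] {k : ℕ} (A : Finset G)
    (s : Fin k → G) : ind (translateInter A s) = fun z => ∏ j, ind A (z + s j) := by
  funext z
  simp [ind, translateInter, Finset.prod_ite_zero]

lemma sum_card_translateInter {G : Type*} [AddCommGroup G] [Fintype G] (k : ℕ) (A : Finset G) :
    ∑ s : Fin k → G, ((translateInter A s).card : ℝ) =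
      (Fintype.card G : ℝ) * (A.card : ℝ) ^ k := by
  rw [← sum_ind A, ← sum_conv]
  refine Finset.sum_congr rfl fun s _ => ?_
  rw [← sum_ind, ind_translateInter, conv]

lemma sum_conv_translateInter {G : Type*} [AddCommGroup G] [Fintype G] (k l : ℕ) (A : Finset G)
    (x : Fin l → G) :
    ∑ s : Fin k → G, conv G l (ind (translateInter A s)) x =
      (Fintype.card G : ℝ) * conv G l (ind A) x ^ k := by
  simp_rw [ind_translateInter, sum_conv_prod_translates]

lemma sum_card_translateInter_pow {G : Type*} [AddCommGroup G] [Fintype G] (k l : ℕ)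
    (A : Finset G) :
    ∑ s : Fin k → G, ((translateInter A s).card : ℝ) ^ l = energy G k l (ind A) := by
  have hN : (Fintype.card G : ℝ) ≠ 0 := by exact_mod_cast Fintype.card_ne_zero
  apply mul_left_cancel₀ hN
  rw [energy, Finset.mul_sum, Finset.mul_sum]
  simp_rw [← sum_conv_translateInter]
  rw [Finset.sum_comm]
  simp_rw [sum_conv, sum_ind]

lemma ratio_pow_le {ε η : ℝ} {m : ℕ} (hε : 0 < ε) (hη : 0 < η) (hη1 : η < 1)
    (hm : 4 * (min ε 1)⁻¹ * Lg η ≤ (m : ℝ)) :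
    (1 + ε / 4) ^ m ≤ η * (1 + ε) ^ m := by
  set e := min ε 1 with he
  have he0 : 0 < e := lt_min hε one_pos
  have he1 : e ≤ 1 := min_le_right _ _
  have heε : e ≤ ε := min_le_left _ _
  have hbase : 1 + ε / 4 ≤ Real.exp (-(3 * e / 8)) * (1 + ε) := by
    have h1 : 1 - 3 * e / 8 ≤ Real.exp (-(3 * e / 8)) := by
      have := Real.add_one_le_exp (-(3 * e / 8)); linarith
    have h2 : e * (1 + ε) ≤ 2 * ε := by
      nlinarith
    nlinarith [mul_le_mul_of_nonneg_right h1 (by linarith : (0 : ℝ) ≤ 1 + ε)]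
  have hlog : Real.log (1 / η) ≤ Lg η := by
    have hpos : 0 ≤ Real.log (2 / η) := Real.log_nonneg (by rw [le_div_iff₀ hη]; linarith)
    have hlog2 : Real.log 2 ≤ 1 := by linarith [Real.log_two_lt_d9]
    calc Real.log (1 / η) ≤ Real.log (2 / η) :=
          Real.log_le_log (by positivity) (by gcongr; norm_num)
      _ ≤ Lg η := by
          rw [Lg, Real.logb, le_div_iff₀ (Real.log_pos (by norm_num))]
          nlinarith
  have hlogη : Real.log η < 0 := Real.log_neg hη hη1
  have hexp : Real.exp (-(3 * e / 8)) ^ m ≤ η := by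
    rw [← Real.exp_nat_mul, ← Real.le_log_iff_exp_le hη]
    have h3 : 4 * Lg η ≤ e * m := by
      have := mul_le_mul_of_nonneg_left hm he0.le
      have h4 : e * (4 * e⁻¹ * Lg η) = 4 * Lg η := by field_simp
      linarith
    rw [one_div, Real.log_inv] at hlog
    nlinarith
  calc (1 + ε / 4) ^ m ≤ (Real.exp (-(3 * e / 8)) * (1 + ε)) ^ m := by gcongr
    _ = Real.exp (-(3 * e / 8)) ^ m * (1 + ε) ^ m := mul_pow _ _ _
    _ ≤ η * (1 + ε) ^ m := by gcongr

/-- If the terms of `f` at most `τ` carry less than half of the mass of `f ^ l`, and `b` has total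
mass at most an `η` proportion of that of `f ^ l`, then `b ≤ 2 η f ^ l` somewhere with `τ < f`. -/
lemma exists_large_of_sum_le {ι : Type*} [Fintype ι] (f b : ι → ℝ) {l : ℕ} {τ η : ℝ}
    (hl : 1 ≤ l) (hη : 0 < η) (hf : ∀ i, 0 ≤ f i) (hb : ∀ i, 0 ≤ b i)
    (hsmall : τ ^ (l - 1) * ∑ i, f i < (∑ i, f i ^ l) / 2)
    (hbsum : ∑ i, b i ≤ η * ∑ i, f i ^ l) (hτ : 0 ≤ τ) :
    ∃ i, τ < f i ∧ b i ≤ 2 * η * f i ^ l := by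
  by_contra! hcon
  have hsplit := Finset.sum_filter_add_sum_filter_not Finset.univ (fun i => τ < f i)
    (fun i => f i ^ l)
  have hlow : ∑ i with ¬ τ < f i, f i ^ l ≤ τ ^ (l - 1) * ∑ i, f i := by
    rw [Finset.mul_sum]
    calc ∑ i with ¬ τ < f i, f i ^ l ≤ ∑ i with ¬ τ < f i, τ ^ (l - 1) * f i := by
          refine Finset.sum_le_sum fun i hi => ?_
          have hi' : f i ≤ τ := not_lt.mp (Finset.mem_filter.mp hi).2
          rw [← pow_sub_one_mul (by omega : l ≠ 0)]
          have := hf i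
          gcongr
      _ ≤ ∑ i, τ ^ (l - 1) * f i :=
          Finset.sum_le_sum_of_subset_of_nonneg (Finset.filter_subset _ _)
            fun i _ _ => mul_nonneg (pow_nonneg hτ _) (hf i)
  have hhigh : 2 * η * ∑ i with τ < f i, f i ^ l ≤ ∑ i, b i := by
    rw [Finset.mul_sum]
    calc ∑ i with τ < f i, 2 * η * f i ^ l ≤ ∑ i with τ < f i, b i :=
          Finset.sum_le_sum fun i hi => (hcon i (Finset.mem_filter.mp hi).2).le
      _ ≤ ∑ i, b i :=
          Finset.sum_le_sum_of_subset_of_nonneg (Finset.filter_subset _ _) fun i _ _ => hb i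
  nlinarith

theorem statement6 {G : Type*} [AddCommGroup G] [Fintype G]
    (A : Finset G) (δ ε η : ℝ) (k l : ℕ)
    (hδ : 0 < δ) (hAcard : (A.card : ℝ) = δ * (Fintype.card G : ℝ))
    (hε : 0 < ε) (hη : η ∈ Set.Ioo (0 : ℝ) (1 / 2))
    (hk : 2 ≤ k) (hl : 2 ≤ l)
    (hkl : 4 * (min ε 1)⁻¹ * Lg η ≤ ((k : ℝ) * (l : ℝ)))
    (hE : (1 + ε) ^ (l * k) * δ ^ (l * k) * (Fintype.card G : ℝ) ^ (l + k) ≤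
      energy G k l (ind A)) :
    ∃ B : Finset G,
      (2 : ℝ) ^ (-(1 / ((l : ℝ) - 1))) * (1 + ε) ^ k * δ ^ k * (Fintype.card G : ℝ) <
        (B.card : ℝ) ∧
      (1 - 2 * η) * (B.card : ℝ) ^ l ≤
        (Fintype.card G : ℝ)⁻¹ *
          ∑ x ∈ Finset.univ.filter
              (fun x : Fin l → G =>
                (1 + ε / 4) ^ l * δ ^ l * (Fintype.card G : ℝ) ≤ conv G l (ind A) x),
            conv G l (ind B) x := by
  obtain ⟨hη0, hη2⟩ := hη
  set N : ℝ := (Fintype.card G : ℝ) with hNdef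
  have hN : 0 < N := by rw [hNdef]; exact_mod_cast Fintype.card_pos
  set T : ℝ := (1 + ε / 4) ^ l * δ ^ l * N with hT
  set τ : ℝ := (2 : ℝ) ^ (-(1 / ((l : ℝ) - 1))) * (1 + ε) ^ k * δ ^ k * N with hτ
  set S := Finset.univ.filter (fun x : Fin l → G => T ≤ conv G l (ind A) x) with hS
  set S' := Finset.univ.filter (fun x : Fin l → G => ¬ T ≤ conv G l (ind A) x) with hS'
  have hroot : ((2 : ℝ) ^ (-(1 / ((l : ℝ) - 1)))) ^ (l - 1) = 1 / 2 := by
    have hl1 : ((l : ℝ) - 1) ≠ 0 := by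
      have : (2 : ℝ) ≤ l := by exact_mod_cast hl
      linarith
    rw [← Real.rpow_mul_natCast (by norm_num), Nat.cast_sub (by omega : 1 ≤ l), Nat.cast_one,
      neg_mul, one_div_mul_cancel hl1, Real.rpow_neg_one, one_div]
  have hτ0 : 0 < τ := by positivity
  have hsmall : τ ^ (l - 1) * ∑ s : Fin k → G, ((translateInter A s).card : ℝ) <
      (∑ s : Fin k → G, ((translateInter A s).card : ℝ) ^ l) / 2 := by
    rw [sum_card_translateInter, sum_card_translateInter_pow, hAcard]
    refine lt_of_lt_of_le ?_ (div_le_div_of_nonneg_right hE zero_le_two)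
    obtain ⟨n, rfl⟩ : ∃ n, l = n + 1 := ⟨l - 1, by omega⟩
    have hτpow : τ ^ (n + 1 - 1) = 1 / 2 * ((1 + ε) ^ k * δ ^ k * N) ^ n := by
      rw [← hroot, hτ, Nat.add_sub_cancel, ← mul_pow]
      ring
    have hlt : (1 : ℝ) < (1 + ε) ^ k := one_lt_pow₀ (by linarith) (by omega)
    calc τ ^ (n + 1 - 1) * (N * (δ * N) ^ k)
        = (1 / 2 * ((1 + ε) ^ k * δ ^ k * N) ^ n * (N * (δ * N) ^ k)) * 1 := by
          rw [hτpow, mul_one]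
      _ < (1 / 2 * ((1 + ε) ^ k * δ ^ k * N) ^ n * (N * (δ * N) ^ k)) * (1 + ε) ^ k := by
          gcongr
      _ = (1 + ε) ^ ((n + 1) * k) * δ ^ ((n + 1) * k) * N ^ (n + 1 + k) / 2 := by
          ring
  have hbad : ∑ s : Fin k → G, N⁻¹ * ∑ x ∈ S', conv G l (ind (translateInter A s)) x ≤
      η * ∑ s : Fin k → G, ((translateInter A s).card : ℝ) ^ l := by
    rw [sum_card_translateInter_pow, ← Finset.mul_sum, Finset.sum_comm]
    simp_rw [sum_conv_translateInter]
    rw [← Finset.mul_sum, inv_mul_cancel_left₀ hN.ne']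
    have hratio := ratio_pow_le (m := l * k) hε hη0 (by linarith)
      (by push_cast; linarith [mul_comm (k : ℝ) l])
    calc ∑ x ∈ S', conv G l (ind A) x ^ k ≤ ∑ x ∈ S', T ^ k := by
          refine Finset.sum_le_sum fun x hx => ?_
          exact pow_le_pow_left₀ (conv_ind_nonneg _ _ _)
            (not_le.mp (Finset.mem_filter.mp hx).2).le _
      _ ≤ ∑ _x : Fin l → G, T ^ k :=
          Finset.sum_le_sum_of_subset_of_nonneg (Finset.filter_subset _ _)
            fun _ _ _ => by positivity
      _ = (1 + ε / 4) ^ (l * k) * (δ ^ (l * k) * N ^ (l + k)) := by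
          simp only [Finset.sum_const, Finset.card_univ, Fintype.card_fun, Fintype.card_fin,
            nsmul_eq_mul, Nat.cast_pow, ← hNdef, hT]
          ring
      _ ≤ η * (1 + ε) ^ (l * k) * (δ ^ (l * k) * N ^ (l + k)) := by gcongr
      _ = η * ((1 + ε) ^ (l * k) * δ ^ (l * k) * N ^ (l + k)) := by ring
      _ ≤ η * energy G k l (ind A) := by gcongr
  obtain ⟨s, hs, hsb⟩ := exists_large_of_sum_le
    (fun s : Fin k → G => ((translateInter A s).card : ℝ))
    (fun s => N⁻¹ * ∑ x ∈ S', conv G l (ind (translateInter A s)) x) (by omega) hη0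
    (fun _ => Nat.cast_nonneg _)
    (fun _ => mul_nonneg (inv_nonneg.mpr hN.le)
      (Finset.sum_nonneg fun _ _ => conv_ind_nonneg _ _ _))
    hsmall hbad hτ0.le
  refine ⟨translateInter A s, hs, ?_⟩
  have htotal : N⁻¹ * ∑ x ∈ S, conv G l (ind (translateInter A s)) x +
      N⁻¹ * ∑ x ∈ S', conv G l (ind (translateInter A s)) x =
        ((translateInter A s).card : ℝ) ^ l := by
    rw [← mul_add, hS, hS', Finset.sum_filter_add_sum_filter_not, sum_conv, sum_ind,
      inv_mul_cancel_left₀ hN.ne']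
  linarith
end
end

section
/- There is an absolute constant C > 0 with the following property. Let G = F_p^n (p prime), l ≥ 1 an integer, ε ∈ (0,1] a real parameter, B ⊆ G a nonempty set with |B| = βN, β < 1, and f : G^l → [−1,1] a function. Then there is a linear subspace V ≤ G with codim V ≤ C · ε^{-2} · l · L(β)^2 · L(ε β^l)^2 such that | Σ_{x∈G^l} f(x) · (B^l ∘ D_l(1_B ∗ μ_V))(x) − Σ_{x∈G^l} f(x) · (B^l ∘ D_l(1_B))(x) | ≤ ε |B|^{l+1}. -/
open scoped BigOperators

attribute [local instance] Classical.propDecidable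

noncomputable section

/-- `D_l(h)(x) = h(x_1)` if all coordinates of `x` are equal, and `0` otherwise. -/
def diag {G : Type*} [Fintype G] (l : ℕ) (h : G → ℝ) (x : Fin l → G) : ℝ :=
  ∑ g : G, if (∀ i, x i = g) then h g else 0

/-- `B^l`, the indicator of the product set `B × ⋯ × B`. -/
def prodInd {G : Type*} (l : ℕ) (B : Finset G) (x : Fin l → G) : ℝ :=
  ∏ i : Fin l, ind B (x i)

/-- `(F ∘ H)(x) = Σ_{y ∈ G^l} F(y) H(y + x)`. -/
def circL {G : Type*} [AddCommGroup G] [Fintype G] (l : ℕ)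
    (F H : (Fin l → G) → ℝ) (x : Fin l → G) : ℝ :=
  ∑ y : Fin l → G, F y * H (y + x)

/-- The normalized indicator `μ_V = 1_V / |V|` of a subspace. -/
def muV {p n : ℕ} [Fact p.Prime] (V : Submodule (ZMod p) (Fin n → ZMod p)) :
    (Fin n → ZMod p) → ℝ :=
  fun y => (if y ∈ V then (1 : ℝ) else 0) / (Fintype.card V : ℝ)

/-- **Hoeffding's lemma** for the uniform measure on a finite set. -/
theorem sum_exp_le_card_mul_exp {ι : Type*} (s : Finset ι) (u : ι → ℝ) {M : ℝ}
    (hu : ∀ i ∈ s, |u i| ≤ M) (h0 : ∑ i ∈ s, u i = 0) :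
    ∑ i ∈ s, Real.exp (u i) ≤ s.card * Real.exp (M ^ 2 / 2) := by
  rcases s.eq_empty_or_nonempty with rfl | ⟨i₀, hi₀⟩
  · simp
  rcases ((abs_nonneg _).trans (hu i₀ hi₀)).eq_or_lt with rfl | hM
  · have h : ∀ i ∈ s, Real.exp (u i) = 1 := fun i hi => by
      rw [abs_nonpos_iff.mp (hu i hi), Real.exp_zero]
    rw [Finset.sum_congr rfl h]
    simp
  have key : ∀ i ∈ s, Real.exp (u i) ≤ Real.cosh M + u i * (Real.sinh M / M) := by
    intro i hi
    obtain ⟨h1, h2⟩ := abs_le.mp (hu i hi)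
    have hc := convexOn_exp.2 (Set.mem_univ M) (Set.mem_univ (-M))
      (div_nonneg (by linarith) (by linarith) : 0 ≤ (M + u i) / (2 * M))
      (div_nonneg (by linarith) (by linarith) : 0 ≤ (M - u i) / (2 * M))
      (by field_simp; ring)
    have e1 : ((M + u i) / (2 * M)) • M + ((M - u i) / (2 * M)) • (-M) = u i := by
      simp only [smul_eq_mul]; field_simp; ring
    rw [e1] at hc
    refine hc.trans (le_of_eq ?_)
    simp only [smul_eq_mul, Real.cosh_eq, Real.sinh_eq]
    field_simp
    ring
  calc ∑ i ∈ s, Real.exp (u i) ≤ ∑ i ∈ s, (Real.cosh M + u i * (Real.sinh M / M)) :=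
        Finset.sum_le_sum key
    _ = s.card * Real.cosh M := by
        rw [Finset.sum_add_distrib, ← Finset.sum_mul, h0]; simp
    _ ≤ _ := by gcongr; exact Real.cosh_le_exp_half_sq M

/-- A set carrying a proportion `β` of the space cannot see a large average of a function whose
two-sided exponential moment is small. -/
theorem abs_sum_le_of_sum_exp_le {G : Type*} [Fintype G] (h : G → ℝ) {β K θ : ℝ} (hβ : 0 < β)
    (hK : 0 < K) (hθ : Real.log (K / β) ≤ θ)
    (hexp : ∑ z, (Real.exp (h z) + Real.exp (-h z)) ≤ K * Fintype.card G)
    (S : Finset G) (hS : β * Fintype.card G ≤ S.card) : |∑ z ∈ S, h z| ≤ θ * S.card := by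
  rcases S.eq_empty_or_nonempty with rfl | hne
  · simp
  have hSpos : (0 : ℝ) < S.card := by exact_mod_cast hne.card_pos
  have main : ∀ h' : G → ℝ, ∑ z, Real.exp (h' z) ≤ K * Fintype.card G →
      ∑ z ∈ S, h' z ≤ θ * S.card := by
    intro h' hh
    have hj := convexOn_exp.map_sum_le (t := S) (w := fun _ => (S.card : ℝ)⁻¹) (p := h')
      (fun _ _ => by positivity) (by simp [hSpos.ne']) (fun _ _ => Set.mem_univ _)
    simp only [smul_eq_mul, ← Finset.mul_sum] at hj
    have h1 : ∑ z ∈ S, Real.exp (h' z) ≤ (K / β) * S.card :=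
      calc ∑ z ∈ S, Real.exp (h' z) ≤ ∑ z, Real.exp (h' z) :=
            Finset.sum_le_sum_of_subset_of_nonneg (Finset.subset_univ _)
              (fun _ _ _ => (Real.exp_pos _).le)
        _ ≤ K * Fintype.card G := hh
        _ = (K / β) * (β * Fintype.card G) := by field_simp
        _ ≤ _ := by gcongr
    have h2 : Real.exp ((S.card : ℝ)⁻¹ * ∑ z ∈ S, h' z) ≤ K / β := by
      refine hj.trans ?_
      rw [inv_mul_le_iff₀ hSpos]
      linarith
    have h3 := (Real.le_log_iff_exp_le (by positivity)).mpr h2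
    rw [inv_mul_le_iff₀ hSpos] at h3
    nlinarith
  rw [abs_le]
  constructor
  · have := main (fun z => -h z) (le_trans (Finset.sum_le_sum fun z _ => by
      have := Real.exp_pos (h z); linarith) hexp)
    rw [Finset.sum_neg_distrib] at this
    linarith
  · exact main h (le_trans (Finset.sum_le_sum fun z _ => by
      have := Real.exp_pos (-h z); linarith) hexp)

/-- The expectation of the exponential of a sum of independent centred samples. -/
theorem sum_piFinset_exp_le {ι : Type*} (P : Finset ι) (u : ι → ℝ) {M : ℝ} (k : ℕ)
    (hu : ∀ i ∈ P, |u i| ≤ M) (h0 : ∑ i ∈ P, u i = 0) :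
    ∑ y ∈ Fintype.piFinset (fun _ : Fin k => P), Real.exp (∑ j, u (y j)) ≤
      (P.card : ℝ) ^ k * Real.exp (k * (M ^ 2 / 2)) := by
  simp only [Real.exp_sum]
  rw [← Finset.prod_univ_sum (fun _ : Fin k => P) (fun _ i => Real.exp (u i))]
  rw [Finset.prod_const, Finset.card_univ, Fintype.card_fin, Real.exp_nat_mul, ← mul_pow]
  exact pow_le_pow_left₀ (Finset.sum_nonneg fun _ _ => (Real.exp_pos _).le)
    (sum_exp_le_card_mul_exp P u hu h0) k

/-- **Croot–Sisask sampling**: at least half of the `k`-tuples of samples from a family of bounded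
functions have an average close to the mean of the family, uniformly over all large sets. -/
theorem card_le_two_mul_card_good_samples {ι G : Type*} [Fintype G] (P : Finset ι)
    (g : ι → G → ℝ) (hg : ∀ y z, |g y z| ≤ 1) {m : G → ℝ}
    (hm : ∀ z, ∑ y ∈ P, g y z = P.card * m z) (hm1 : ∀ z, |m z| ≤ 1) {β δ : ℝ} (hβ : 0 < β)
    (hδ : 0 < δ) {k : ℕ} (hk : 0 < k) (hkδ : 8 * Real.log (4 / β) ≤ k * δ ^ 2) :
    (P.card : ℝ) ^ k ≤ 2 * ((Fintype.piFinset (fun _ : Fin k => P)).filter fun y =>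
      ∀ S : Finset G, β * Fintype.card G ≤ S.card →
        |∑ z ∈ S, (∑ j, g (y j) z - k * m z)| ≤ δ * k * S.card).card := by
  set Q := Fintype.piFinset (fun _ : Fin k => P) with hQ
  set lam : ℝ := δ / 4 with hlam
  set E : ℝ := Real.exp (k * ((2 * lam) ^ 2 / 2)) with hE
  have hkpos : (0 : ℝ) < k := by exact_mod_cast hk
  have hEpos : 0 < E := Real.exp_pos _
  let Ψ : (Fin k → ι) → ℝ := fun y =>
    ∑ z, (Real.exp (lam * (∑ j, g (y j) z - k * m z)) +
      Real.exp (-(lam * (∑ j, g (y j) z - k * m z))))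
  have hΨ0 : ∀ y, 0 ≤ Ψ y := fun y =>
    Finset.sum_nonneg fun z _ => by positivity
  have bd : ∀ z (c : ℝ), |c| = lam → ∑ y ∈ Q, Real.exp (c * (∑ j, g (y j) z - k * m z)) ≤
      (P.card : ℝ) ^ k * E := by
    intro z c hc
    have := sum_piFinset_exp_le P (fun y => c * (g y z - m z)) (M := 2 * lam) k
      (fun y _ => by
        rw [abs_mul, hc, mul_comm]
        gcongr
        exact (abs_sub _ _).trans (by linarith [hg y z, hm1 z]))
      (by rw [← Finset.mul_sum, Finset.sum_sub_distrib, hm]; simp)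
    refine le_trans (le_of_eq ?_) this
    refine Finset.sum_congr rfl fun y _ => ?_
    rw [← Finset.mul_sum, Finset.sum_sub_distrib]
    simp
  have htot : ∑ y ∈ Q, Ψ y ≤ 2 * E * Fintype.card G * (P.card : ℝ) ^ k := by
    simp only [Ψ]
    rw [Finset.sum_comm]
    have hl : |lam| = lam := abs_of_pos (by positivity)
    calc _ ≤ ∑ z : G, ((P.card : ℝ) ^ k * E + (P.card : ℝ) ^ k * E) := by
          refine Finset.sum_le_sum fun z _ => ?_
          rw [Finset.sum_add_distrib]
          refine add_le_add (bd z lam hl) ?_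
          have := bd z (-lam) (by rw [abs_neg, hl])
          simpa only [neg_mul] using this
      _ = _ := by
          rw [Finset.sum_const, Finset.card_univ, nsmul_eq_mul]; ring
  set good := Q.filter fun y => ∀ S : Finset G, β * Fintype.card G ≤ S.card →
        |∑ z ∈ S, (∑ j, g (y j) z - k * m z)| ≤ δ * k * S.card with hgood
  have hbad : ∀ y ∈ Q.filter (fun y => y ∉ good), 4 * E * Fintype.card G ≤ Ψ y := by
    intro y hy
    rw [Finset.mem_filter] at hy
    by_contra! hlt
    refine hy.2 (Finset.mem_filter.mpr ⟨hy.1, fun S hS => ?_⟩)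
    have hθ : Real.log (4 * E / β) ≤ lam * (δ * k) := by
      rw [show 4 * E / β = (4 / β) * E by ring, Real.log_mul (by positivity) hEpos.ne', hE,
        Real.log_exp, hlam]
      nlinarith
    have := abs_sum_le_of_sum_exp_le (fun z => lam * (∑ j, g (y j) z - k * m z)) hβ
      (by positivity : 0 < 4 * E) hθ hlt.le S hS
    rw [← Finset.mul_sum, abs_mul, abs_of_pos (by positivity : 0 < lam), mul_assoc] at this
    exact le_of_mul_le_mul_left this (by positivity)
  have hQcard : (Q.card : ℝ) = (P.card : ℝ) ^ k := by
    rw [hQ, Fintype.card_piFinset]; simp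
  have hsplit : (Q.card : ℝ) = good.card + (Q.filter (fun y => y ∉ good)).card := by
    have h1 := Finset.card_filter_add_card_filter_not (s := Q) (fun y => y ∈ good)
    have h2 : Q.filter (fun y => y ∈ good) = good := by
      ext y
      simp only [hgood, Finset.mem_filter]
      tauto
    rw [h2] at h1
    exact_mod_cast h1.symm
  rcases isEmpty_or_nonempty G with hG | hG
  · have : good = Q := by
      rw [hgood, Finset.filter_eq_self]
      intro y _ S _
      rw [Finset.eq_empty_of_isEmpty S]
      simp
    rw [this, ← hQcard]
    linarith [(Nat.cast_nonneg Q.card : (0:ℝ) ≤ Q.card)]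
  have hN : (0 : ℝ) < Fintype.card G := by exact_mod_cast Fintype.card_pos
  have h4 : ((Q.filter (fun y => y ∉ good)).card : ℝ) * (4 * E * Fintype.card G) ≤
      2 * E * Fintype.card G * (P.card : ℝ) ^ k := by
    refine le_trans ?_ ((Finset.sum_le_sum_of_subset_of_nonneg (Q.filter_subset fun y => y ∉ good)
      (fun y _ _ => hΨ0 y)).trans htot)
    rw [← nsmul_eq_mul]
    exact Finset.card_nsmul_le_sum _ _ _ hbad
  have h5 : 2 * ((Q.filter (fun y => y ∉ good)).card : ℝ) ≤ (P.card : ℝ) ^ k := by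
    have : 0 < 2 * E * Fintype.card G := by positivity
    nlinarith
  linarith

/-- For any map `φ : G → H` into a finite group, some reflected translate of a subset of `H` has a
preimage under `φ` at least as dense as the subset. -/
theorem exists_card_mul_card_le_card_translate {G H : Type*} [Fintype G]
    [AddCommGroup H] [Fintype H] (φ : G → H) (Y : Finset H) :
    ∃ (u : H) (X : Finset G), (∀ t ∈ X, u - φ t ∈ Y) ∧
      Fintype.card G * Y.card ≤ X.card * Fintype.card H := by
  have hcount : ∑ u : H, (Finset.univ.filter fun t : G => u - φ t ∈ Y).card =
      Fintype.card G * Y.card := by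
    simp only [Finset.card_filter]
    rw [Finset.sum_comm]
    have : ∀ t : G, ∑ u : H, (if u - φ t ∈ Y then 1 else 0) = Y.card := fun t => by
      calc ∑ u : H, (if u - φ t ∈ Y then 1 else 0) = ∑ u : H, (if u ∈ Y then 1 else 0) :=
            Fintype.sum_equiv (Equiv.subRight (φ t)) _ _ fun u => rfl
        _ = Y.card := by simp
    simp [this]
  obtain ⟨u, -, hu⟩ := Finset.exists_le_of_sum_le (s := (Finset.univ : Finset H))
    (f := fun _ => Fintype.card G * Y.card)
    (g := fun u => (Finset.univ.filter fun t : G => u - φ t ∈ Y).card * Fintype.card H)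
    ⟨0, Finset.mem_univ _⟩
    (by rw [← Finset.sum_mul, ← Finset.sum_mul, hcount]; simp [mul_comm, mul_left_comm])
  exact ⟨u, _, fun t ht => (Finset.mem_filter.mp ht).2, hu⟩

/-- The average of `f` over the set `z - B ^ l`, with `z` on the diagonal. -/
def diagAverage {G : Type*} [AddCommGroup G] (l : ℕ) (B : Finset G) (f : (Fin l → G) → ℝ)
    (z : G) : ℝ :=
  ((B.card : ℝ) ^ l)⁻¹ * ∑ y ∈ Fintype.piFinset (fun _ : Fin l => B), f (fun i => z - y i)

theorem card_piFinset_const {ι : Type*} (l : ℕ) (B : Finset ι) :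
    ((Fintype.piFinset (fun _ : Fin l => B)).card : ℝ) = (B.card : ℝ) ^ l := by
  rw [Fintype.card_piFinset]; simp

theorem abs_diagAverage_le {G : Type*} [AddCommGroup G] (l : ℕ) {B : Finset G}
    (hB : B.Nonempty) {f : (Fin l → G) → ℝ} (hf : ∀ x, |f x| ≤ 1) (z : G) :
    |diagAverage l B f z| ≤ 1 := by
  have hpos : (0 : ℝ) < (B.card : ℝ) ^ l := pow_pos (by exact_mod_cast hB.card_pos) l
  rw [diagAverage, abs_mul, abs_of_pos (inv_pos.mpr hpos), inv_mul_le_iff₀ hpos, mul_one,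
    ← card_piFinset_const]
  refine (Finset.abs_sum_le_sum_abs _ _).trans ((Finset.sum_le_sum fun y _ => hf _).trans ?_)
  simp

/-- The mean of `g` over the translate `B + w`. -/
def translateMean {G : Type*} [AddCommGroup G] (B : Finset G) (g : G → ℝ) (w : G) : ℝ :=
  (B.card : ℝ)⁻¹ * ∑ z ∈ B, g (z + w)

/-- Diagonal averages of a bounded function have many almost periods, measured by means over
translates of `B`. -/
theorem exists_almost_periods {G : Type*} [AddCommGroup G] [Fintype G] {l : ℕ}
    {B : Finset G} (hB : B.Nonempty) {β : ℝ} (hβ : (B.card : ℝ) = β * Fintype.card G)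
    {f : (Fin l → G) → ℝ} (hf : ∀ x, |f x| ≤ 1) {δ : ℝ} (hδ : 0 < δ) {k : ℕ} (hk : 0 < k)
    (hkδ : 8 * Real.log (4 / β) ≤ k * δ ^ 2) :
    ∃ X : Finset G, β ^ (l * k) * Fintype.card G ≤ 2 * X.card ∧
      ∀ t ∈ X, ∀ t' ∈ X, ∀ w, |translateMean B (diagAverage l B f) (w + t - t') -
        translateMean B (diagAverage l B f) w| ≤ 2 * δ := by
  have hN : (0 : ℝ) < Fintype.card G := by exact_mod_cast Fintype.card_pos
  have hBpos : (0 : ℝ) < B.card := by exact_mod_cast hB.card_pos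
  have hkpos : (0 : ℝ) < k := by exact_mod_cast hk
  have hβpos : 0 < β := by
    rw [hβ] at hBpos
    exact pos_of_mul_pos_left hBpos hN.le
  set m := diagAverage l B f with hm
  have hgood := card_le_two_mul_card_good_samples (Fintype.piFinset (fun _ : Fin l => B))
    (fun y (z : G) => f (fun i => z - y i)) (fun y z => hf _) (m := m)
    (fun z => by
      rw [card_piFinset_const, hm, diagAverage, mul_inv_cancel_left₀ (by positivity)])
    (abs_diagAverage_le l hB hf) hβpos hδ hk hkδ
  set Y := (Fintype.piFinset fun _ : Fin k => Fintype.piFinset fun _ : Fin l => B).filter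
    fun y => ∀ S : Finset G, β * Fintype.card G ≤ S.card →
      |∑ z ∈ S, (∑ j, f (fun i => z - y j i) - k * m z)| ≤ δ * k * S.card
  obtain ⟨u, X, hX, hu⟩ := exists_card_mul_card_le_card_translate
    (fun (t : G) (_ : Fin k) (_ : Fin l) => t) Y
  refine ⟨X, ?_, ?_⟩
  · have hH : (Fintype.card (Fin k → Fin l → G) : ℝ) = (Fintype.card G : ℝ) ^ (l * k) := by
      simp [Fintype.card_pi, pow_mul]
    have hu' : (Fintype.card G : ℝ) * Y.card ≤ X.card * (Fintype.card G : ℝ) ^ (l * k) := by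
      rw [← hH]; exact_mod_cast hu
    rw [card_piFinset_const, ← pow_mul, hβ, mul_pow] at hgood
    have hNk : (0 : ℝ) < (Fintype.card G : ℝ) ^ (l * k) := by positivity
    refine le_of_mul_le_mul_right ?_ hNk
    nlinarith
  · have hshift : ∀ t ∈ X, ∀ w, |∑ z ∈ B, (∑ j, f (fun i => z + w - u j i) - k * m (z + w - t))| ≤
        δ * k * B.card := by
      intro t ht w
      have ht' := (Finset.mem_filter.mp (hX t ht)).2
        (B.map (Equiv.addRight (w - t)).toEmbedding) (by rw [Finset.card_map, hβ])
      rw [Finset.card_map, Finset.sum_map] at ht'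
      convert ht' using 6 with z _ j _
      · simp only [Pi.sub_apply, Equiv.coe_toEmbedding, Equiv.coe_addRight]
        funext i
        abel
      · simp only [Equiv.coe_toEmbedding, Equiv.coe_addRight]
        abel
    intro t ht t' ht' w
    have h1 := hshift t ht (w + t)
    have h2 := hshift t' ht' (w + t)
    have hk1 : ∀ a b c : G, a + (b + c) - c = a + b := fun a b c => by abel
    rw [Finset.sum_sub_distrib, ← Finset.mul_sum] at h1 h2
    simp only [hk1] at h1
    have hk2 : ∀ z : G, z + (w + t) - t' = z + (w + t - t') := fun z => by abel
    simp only [hk2] at h2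
    rw [translateMean, translateMean, ← mul_sub, abs_mul, abs_of_pos (inv_pos.mpr hBpos),
      inv_mul_le_iff₀ hBpos]
    refine le_of_mul_le_mul_left ?_ hkpos
    rw [← abs_of_pos hkpos, ← abs_mul, abs_of_pos hkpos, abs_le]
    rw [abs_le] at h1 h2
    constructor <;> nlinarith [h1.1, h1.2, h2.1, h2.2]

/-- Averaging over the fibres of a surjective additive map gives the uniform average. -/
theorem card_mul_sum_comp_of_surjective {G H : Type*} [AddCommGroup G] [Fintype G]
    [AddCommGroup H] [Fintype H] (Φ : G →+ H) (hΦ : Function.Surjective Φ) (F : H → ℝ) :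
    Fintype.card H * ∑ x, F (Φ x) = Fintype.card G * ∑ u, F u := by
  have h1 : ∀ u : H, ∑ x, F (Φ x + u) = ∑ x, F (Φ x) := fun u => by
    obtain ⟨w, rfl⟩ := hΦ u
    exact Fintype.sum_equiv (Equiv.addRight w) _ _ fun x => by simp
  have h2 : ∀ x : G, ∑ u, F (Φ x + u) = ∑ u, F u := fun x =>
    Fintype.sum_equiv (Equiv.addLeft (Φ x)) _ _ fun u => rfl
  calc Fintype.card H * ∑ x, F (Φ x) = ∑ u : H, ∑ x, F (Φ x + u) := by simp [h1]
    _ = ∑ x, ∑ u : H, F (Φ x + u) := Finset.sum_comm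
    _ = _ := by simp [h2]

theorem sum_stdAddChar_eq_zero (p : ℕ) [Fact p.Prime] :
    ∑ a : ZMod p, ZMod.stdAddChar a = (0 : ℂ) := by
  have := AddChar.sum_mulShift (1 : ZMod p) (ZMod.isPrimitive_stdAddChar p)
  simpa using this

theorem exists_norm_le_one_mul_eq_norm (z : ℂ) : ∃ c : ℂ, ‖c‖ ≤ 1 ∧ c * z = ‖z‖ := by
  rcases eq_or_ne z 0 with rfl | hz
  · exact ⟨0, by simp⟩
  · have hz' : (‖z‖ : ℂ) ≠ 0 := by exact_mod_cast (norm_ne_zero_iff.mpr hz)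
    refine ⟨(starRingEnd ℂ) z / ‖z‖, ?_, ?_⟩
    · rw [norm_div, Complex.norm_conj, Complex.norm_real, norm_norm,
        div_self (norm_ne_zero_iff.mpr hz)]
    · rw [div_mul_eq_mul_div, Complex.conj_mul', sq, mul_div_assoc, div_self hz', mul_one]

/-- Linearly independent frequencies in the large spectrum of `X` number at most
`8 log (N / |X|)`. -/
theorem card_le_of_linearIndependent_large_spectrum {p n : ℕ} [Fact p.Prime]
    {ι : Type*} [Fintype ι] (r : ι → Fin n → ZMod p)
    (hr : Function.Surjective fun (x : Fin n → ZMod p) i => r i ⬝ᵥ x)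
    {X : Finset (Fin n → ZMod p)} (hX : X.Nonempty)
    (hspec : ∀ i, (1 / 2 : ℝ) * X.card ≤ ‖∑ t ∈ X, (ZMod.stdAddChar (r i ⬝ᵥ t) : ℂ)‖) :
    (Fintype.card ι : ℝ) ≤ 8 * Real.log (Fintype.card (Fin n → ZMod p) / X.card) := by
  have hXpos : (0 : ℝ) < X.card := by exact_mod_cast hX.card_pos
  choose c hc1 hc2 using fun i =>
    exists_norm_le_one_mul_eq_norm (∑ t ∈ X, (ZMod.stdAddChar (r i ⬝ᵥ t) : ℂ))
  let φ : ι → ZMod p → ℝ := fun i a => (c i * ZMod.stdAddChar a).re / 2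
  have hφ1 : ∀ i a, |φ i a| ≤ 1 / 2 := fun i a => by
    have : |(c i * ZMod.stdAddChar a).re| ≤ 1 := by
      refine (Complex.abs_re_le_norm _).trans ?_
      rw [norm_mul, AddChar.norm_apply, mul_one]
      exact hc1 i
    simp only [φ]
    rw [abs_div, abs_two]
    linarith
  have hφ0 : ∀ i, ∑ a, φ i a = 0 := fun i => by
    simp only [φ]
    rw [← Finset.sum_div, ← Complex.re_sum, ← Finset.mul_sum, sum_stdAddChar_eq_zero]
    simp
  have hφX : ∀ i, (1 / 4 : ℝ) * X.card ≤ ∑ t ∈ X, φ i (r i ⬝ᵥ t) := fun i => by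
    simp only [φ]
    rw [← Finset.sum_div, ← Complex.re_sum, ← Finset.mul_sum, hc2, Complex.ofReal_re]
    linarith [hspec i]
  set d : ℝ := (Fintype.card ι : ℝ)
  let Φ : (Fin n → ZMod p) →+ (ι → ZMod p) :=
    { toFun := fun x i => r i ⬝ᵥ x
      map_zero' := by ext; simp
      map_add' := fun x y => by ext; simp [dotProduct_add] }
  have hmgf : ∑ x : Fin n → ZMod p, Real.exp (∑ i, φ i (r i ⬝ᵥ x)) ≤
      Fintype.card (Fin n → ZMod p) * Real.exp (d / 8) := by
    have h1 := card_mul_sum_comp_of_surjective Φ hr fun u => Real.exp (∑ i, φ i (u i))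
    have h2 : ∑ u : ι → ZMod p, Real.exp (∑ i, φ i (u i)) ≤
        Fintype.card (ι → ZMod p) * Real.exp (d / 8) := by
      simp only [Real.exp_sum]
      rw [← Fintype.piFinset_univ,
        ← Finset.prod_univ_sum (fun _ : ι => (Finset.univ : Finset (ZMod p)))
          (fun i a => Real.exp (φ i a))]
      calc ∏ i, ∑ a, Real.exp (φ i a) ≤ ∏ i : ι, ((p : ℝ) * Real.exp (1 / 8)) := by
            refine Finset.prod_le_prod (fun i _ => Finset.sum_nonneg fun _ _ =>
              (Real.exp_pos _).le) fun i _ => ?_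
            have := sum_exp_le_card_mul_exp Finset.univ (φ i) (fun a _ => hφ1 i a) (hφ0 i)
            rwa [Finset.card_univ, ZMod.card,
              show ((1 : ℝ) / 2) ^ 2 / 2 = 1 / 8 by norm_num] at this
        _ = _ := by
            rw [Finset.prod_const, mul_pow, ← Real.exp_nat_mul]
            simp [d, div_eq_mul_inv]
    have hH : (0 : ℝ) < Fintype.card (ι → ZMod p) := by exact_mod_cast Fintype.card_pos
    refine le_of_mul_le_mul_left ?_ hH
    calc _ = _ := h1
      _ ≤ Fintype.card (Fin n → ZMod p) * (Fintype.card (ι → ZMod p) * Real.exp (d / 8)) := by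
        gcongr
      _ = _ := by ring
  have hj := convexOn_exp.map_sum_le (t := X) (w := fun _ => (X.card : ℝ)⁻¹)
    (p := fun x => ∑ i, φ i (r i ⬝ᵥ x))
    (fun _ _ => by positivity) (by simp [hXpos.ne']) (fun _ _ => Set.mem_univ _)
  simp only [smul_eq_mul, ← Finset.mul_sum] at hj
  have hlow : d / 4 ≤ (X.card : ℝ)⁻¹ * ∑ x ∈ X, ∑ i, φ i (r i ⬝ᵥ x) := by
    rw [Finset.sum_comm, le_inv_mul_iff₀ hXpos]
    calc (X.card : ℝ) * (d / 4) = ∑ i : ι, (1 / 4 : ℝ) * X.card := by simp [d]; ring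
      _ ≤ _ := Finset.sum_le_sum fun i _ => hφX i
  have hfin : Real.exp (d / 4) ≤
      Fintype.card (Fin n → ZMod p) / X.card * Real.exp (d / 8) := by
    refine (Real.exp_le_exp.mpr hlow).trans (hj.trans ?_)
    rw [inv_mul_le_iff₀ hXpos]
    refine (Finset.sum_le_sum_of_subset_of_nonneg (Finset.subset_univ _)
      (fun _ _ _ => (Real.exp_pos _).le)).trans (hmgf.trans (le_of_eq ?_))
    field_simp
  have hN : (0 : ℝ) < Fintype.card (Fin n → ZMod p) := by exact_mod_cast Fintype.card_pos
  have := (Real.le_log_iff_exp_le (by positivity)).mpr hfin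
  rw [Real.log_mul (by positivity) (by positivity), Real.log_exp] at this
  linarith

/-- **Chang's theorem** in `F_p ^ n`: the large spectrum of `X` is annihilated by a subspace of
codimension `O(log (N / |X|))`. -/
theorem exists_submodule_annihilating_large_spectrum {p n : ℕ} [Fact p.Prime]
    {X : Finset (Fin n → ZMod p)} (hX : X.Nonempty) :
    ∃ V : Submodule (ZMod p) (Fin n → ZMod p),
      ((n - Module.finrank (ZMod p) V : ℕ) : ℝ) ≤
        8 * Real.log (Fintype.card (Fin n → ZMod p) / X.card) ∧
      ∀ r : Fin n → ZMod p,
        (1 / 2 : ℝ) * X.card ≤ ‖∑ t ∈ X, (ZMod.stdAddChar (r ⬝ᵥ t) : ℂ)‖ →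
        ∀ v ∈ V, r ⬝ᵥ v = 0 := by
  obtain ⟨b, hbR, hspan, hli⟩ := exists_linearIndependent (ZMod p)
    {r : Fin n → ZMod p | (1 / 2 : ℝ) * X.card ≤ ‖∑ t ∈ X, (ZMod.stdAddChar (r ⬝ᵥ t) : ℂ)‖}
  let M : Matrix b (Fin n) (ZMod p) := Matrix.of fun r i => (r : Fin n → ZMod p) i
  have hrank : M.rank = Fintype.card b := LinearIndependent.rank_matrix hli
  have hrange : M.mulVecLin.range = ⊤ := by
    refine Submodule.eq_top_of_finrank_eq ?_
    rw [Module.finrank_fintype_fun_eq_card, ← hrank]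
    rfl
  have hcard : (Fintype.card b : ℝ) ≤
      8 * Real.log (Fintype.card (Fin n → ZMod p) / X.card) :=
    card_le_of_linearIndependent_large_spectrum (fun r : b => (r : Fin n → ZMod p))
      (LinearMap.range_eq_top.mp hrange) hX fun r => hbR r.2
  refine ⟨M.mulVecLin.ker, ?_, fun r hr v hv => ?_⟩
  · have hdim := M.mulVecLin.finrank_range_add_finrank_ker
    rw [Module.finrank_fintype_fun_eq_card, Fintype.card_fin] at hdim
    have : n - Module.finrank (ZMod p) M.mulVecLin.ker = Fintype.card b := by
      rw [← hrank, Matrix.rank]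
      omega
    rwa [this]
  · have hrs : r ∈ Submodule.span (ZMod p) b := hspan ▸ Submodule.subset_span hr
    clear hr
    induction hrs using Submodule.span_induction with
    | mem x hx => exact congrFun (LinearMap.mem_ker.mp hv) ⟨x, hx⟩
    | zero => exact zero_dotProduct v
    | add x y _ _ hx hy => rw [add_dotProduct, hx, hy, add_zero]
    | smul a x _ hx => rw [smul_dotProduct, hx, smul_zero]

theorem sum_stdAddChar_dotProduct {p n : ℕ} [Fact p.Prime] (x : Fin n → ZMod p) :
    ∑ r : Fin n → ZMod p, (ZMod.stdAddChar (r ⬝ᵥ x) : ℂ) =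
      if x = 0 then (Fintype.card (Fin n → ZMod p) : ℂ) else 0 := by
  split_ifs with hx
  · simp [hx]
  · let ψ : AddChar (Fin n → ZMod p) ℂ :=
      { toFun := fun r => ZMod.stdAddChar (r ⬝ᵥ x)
        map_zero_eq_one' := by simp
        map_add_eq_mul' := fun a b => by rw [add_dotProduct, AddChar.map_add_eq_mul] }
    refine AddChar.sum_eq_zero_of_ne_one (ψ := ψ) fun hψ => hx (funext fun i => ?_)
    by_contra hi
    have h := sum_stdAddChar_eq_zero p
    have h1 : ∀ a : ZMod p, (ZMod.stdAddChar a : ℂ) = 1 := fun a => by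
      have := DFunLike.congr_fun hψ (Pi.single i (a / x i))
      simpa [ψ, single_dotProduct, div_mul_cancel₀ _ hi] using this
    simp only [h1] at h
    simp [(Fact.out : p.Prime).ne_zero] at h

theorem conj_stdAddChar {p : ℕ} [Fact p.Prime] (a : ZMod p) :
    (starRingEnd ℂ) (ZMod.stdAddChar a) = ZMod.stdAddChar (-a) :=
  (AddChar.map_neg_eq_conj _ a).symm

/-- Parseval's identity in `F_p ^ n`. -/
theorem sum_norm_sq_stdAddChar_transform {p n : ℕ} [Fact p.Prime] (h : (Fin n → ZMod p) → ℝ) :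
    ∑ r : Fin n → ZMod p, ‖∑ x, (h x : ℂ) * ZMod.stdAddChar (r ⬝ᵥ x)‖ ^ 2 =
      Fintype.card (Fin n → ZMod p) * ∑ x, h x ^ 2 := by
  have key : ∀ r : Fin n → ZMod p,
      ((‖∑ x, (h x : ℂ) * ZMod.stdAddChar (r ⬝ᵥ x)‖ ^ 2 : ℝ) : ℂ) =
      ∑ x, ∑ y, (h x : ℂ) * h y * ZMod.stdAddChar (r ⬝ᵥ (x - y)) := fun r => by
    push_cast
    rw [← Complex.mul_conj', map_sum, Finset.sum_mul_sum]
    refine Finset.sum_congr rfl fun x _ => Finset.sum_congr rfl fun y _ => ?_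
    rw [map_mul, Complex.conj_ofReal, conj_stdAddChar, dotProduct_sub, sub_eq_add_neg,
      AddChar.map_add_eq_mul]
    ring
  have : ((∑ r : Fin n → ZMod p, ‖∑ x, (h x : ℂ) * ZMod.stdAddChar (r ⬝ᵥ x)‖ ^ 2 : ℝ) : ℂ) =
      ((Fintype.card (Fin n → ZMod p) * ∑ x, h x ^ 2 : ℝ) : ℂ) := by
    rw [Complex.ofReal_sum, Finset.sum_congr rfl fun r _ => key r, Finset.sum_comm]
    push_cast
    rw [Finset.mul_sum]
    refine Finset.sum_congr rfl fun x _ => ?_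
    rw [Finset.sum_comm]
    simp_rw [← Finset.mul_sum, sum_stdAddChar_dotProduct, sub_eq_zero]
    simp
    ring
  exact_mod_cast this

/-- The means of a bounded function over translates of `B` have absolutely summable Fourier
coefficients, with sum at most `N / |B|`. -/
theorem exists_fourier_expansion_translateMean {p n : ℕ} [Fact p.Prime]
    {B : Finset (Fin n → ZMod p)} (hB : B.Nonempty) {g : (Fin n → ZMod p) → ℝ}
    (hg : ∀ x, |g x| ≤ 1) :
    ∃ c : (Fin n → ZMod p) → ℂ,
      (∀ w, (translateMean B g w : ℂ) = ∑ r, c r * ZMod.stdAddChar (r ⬝ᵥ w)) ∧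
      ∑ r, ‖c r‖ ≤ Fintype.card (Fin n → ZMod p) / B.card := by
  set N : ℝ := (Fintype.card (Fin n → ZMod p) : ℝ) with hN
  have hNpos : 0 < N := by rw [hN]; exact_mod_cast Fintype.card_pos
  have hBpos : (0 : ℝ) < B.card := by exact_mod_cast hB.card_pos
  let T : ((Fin n → ZMod p) → ℝ) → (Fin n → ZMod p) → ℂ := fun h r =>
    ∑ x, (h x : ℂ) * ZMod.stdAddChar (r ⬝ᵥ x)
  let b : (Fin n → ZMod p) → ℝ := fun x => if x ∈ B then 1 else 0
  have hTb : ∀ r, T b r = ∑ z ∈ B, (ZMod.stdAddChar (r ⬝ᵥ z) : ℂ) := fun r => by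
    simp [T, b, apply_ite ((↑) : ℝ → ℂ), ite_mul]
  have hinv : ∀ x, (N : ℂ) * g x =
      ∑ r, (starRingEnd ℂ) (T g r) * ZMod.stdAddChar (r ⬝ᵥ x) := fun x => by
    simp only [T, map_sum, map_mul, Complex.conj_ofReal, conj_stdAddChar, Finset.sum_mul,
      mul_assoc, ← AddChar.map_add_eq_mul, neg_add_eq_sub, ← dotProduct_sub]
    rw [Finset.sum_comm]
    simp_rw [← Finset.mul_sum, sum_stdAddChar_dotProduct, sub_eq_zero]
    simp [hN, mul_comm]
  refine ⟨fun r => (N : ℂ)⁻¹ * (B.card : ℂ)⁻¹ * ((starRingEnd ℂ) (T g r) * T b r), ?_, ?_⟩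
  · intro w
    have hNC : (N : ℂ) ≠ 0 := by exact_mod_cast hNpos.ne'
    have h1 : ∀ x, (g x : ℂ) =
        (N : ℂ)⁻¹ * ∑ r, (starRingEnd ℂ) (T g r) * ZMod.stdAddChar (r ⬝ᵥ x) := fun x => by
      rw [← hinv, inv_mul_cancel_left₀ hNC]
    rw [translateMean]
    push_cast
    simp_rw [h1, hTb, ← Finset.mul_sum, mul_assoc]
    rw [Finset.sum_comm, ← Finset.mul_sum, ← Finset.mul_sum, mul_left_comm]
    congr 2
    refine Finset.sum_congr rfl fun r _ => ?_
    rw [Finset.sum_mul, Finset.mul_sum]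
    refine Finset.sum_congr rfl fun z _ => ?_
    rw [dotProduct_add, AddChar.map_add_eq_mul]
  · have hpg : ∑ r, ‖T g r‖ ^ 2 ≤ N * N := by
      rw [sum_norm_sq_stdAddChar_transform, ← hN]
      gcongr
      calc ∑ x, g x ^ 2 ≤ ∑ x : Fin n → ZMod p, (1 : ℝ) :=
            Finset.sum_le_sum fun x _ => (sq_le_one_iff_abs_le_one _).mpr (hg x)
        _ = N := by simp [hN]
    have hpb : ∑ r, ‖T b r‖ ^ 2 ≤ N * N := by
      rw [sum_norm_sq_stdAddChar_transform, ← hN]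
      gcongr
      calc ∑ x, b x ^ 2 ≤ ∑ x : Fin n → ZMod p, (1 : ℝ) :=
            Finset.sum_le_sum fun x _ => by simp only [b]; split_ifs <;> norm_num
        _ = N := by simp [hN]
    have hsum : ∑ r, ‖T g r‖ * ‖T b r‖ ≤ N * N :=
      calc ∑ r, ‖T g r‖ * ‖T b r‖ ≤ ∑ r, (‖T g r‖ ^ 2 + ‖T b r‖ ^ 2) / 2 :=
            Finset.sum_le_sum fun r _ => by nlinarith [sq_nonneg (‖T g r‖ - ‖T b r‖)]
        _ ≤ N * N := by rw [← Finset.sum_div, Finset.sum_add_distrib]; linarith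
    simp only [norm_mul, norm_inv, Complex.norm_conj, Complex.norm_real, Complex.norm_natCast,
      Real.norm_eq_abs, abs_of_pos hNpos]
    rw [← Finset.mul_sum]
    calc N⁻¹ * (B.card : ℝ)⁻¹ * ∑ r, ‖T g r‖ * ‖T b r‖ ≤ N⁻¹ * (B.card : ℝ)⁻¹ * (N * N) := by
          gcongr
      _ = N / B.card := by field_simp

/-- Repeatedly averaging a function over differences of elements of a set `X` of `η`-almost periods
moves it by at most `η` at each step. -/
theorem norm_iterated_average_sub_le {G : Type*} [AddCommGroup G] {X : Finset G}
    (hX : X.Nonempty) {H : ℕ → G → ℂ} {η : ℝ}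
    (hrec : ∀ j w, H (j + 1) w =
      ((X.card : ℂ) ^ 2)⁻¹ * ∑ t ∈ X, ∑ t' ∈ X, H j (w + t - t'))
    (hη : ∀ t ∈ X, ∀ t' ∈ X, ∀ w, ‖H 0 (w + t - t') - H 0 w‖ ≤ η) (j : ℕ) (w : G) :
    ‖H j w - H 0 w‖ ≤ j * η := by
  have hXpos : (0 : ℝ) < X.card := by exact_mod_cast hX.card_pos
  have havg : ∀ (F : G → G → ℂ),
      (∀ t ∈ X, ∀ t' ∈ X, ‖F t t'‖ ≤ η) →
      ‖((X.card : ℂ) ^ 2)⁻¹ * ∑ t ∈ X, ∑ t' ∈ X, F t t'‖ ≤ η := fun F hF => by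
    rw [norm_mul, norm_inv, norm_pow, Complex.norm_natCast, inv_mul_le_iff₀ (by positivity)]
    calc ‖∑ t ∈ X, ∑ t' ∈ X, F t t'‖ ≤ ∑ t ∈ X, ∑ t' ∈ X, η :=
          norm_sum_le_of_le _ fun t ht => norm_sum_le_of_le _ fun t' ht' => hF t ht t' ht'
      _ = _ := by simp; ring
  have hXC : ((X.card : ℂ) ^ 2) ≠ 0 := by
    have : (X.card : ℂ) ≠ 0 := by exact_mod_cast hXpos.ne'
    positivity
  have hstep : ∀ j w, ‖H (j + 1) w - H j w‖ ≤ η := by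
    intro j
    induction j with
    | zero =>
      intro w
      have : H (0 + 1) w - H 0 w =
          ((X.card : ℂ) ^ 2)⁻¹ * ∑ t ∈ X, ∑ t' ∈ X, (H 0 (w + t - t') - H 0 w) := by
        rw [hrec]
        simp only [Finset.sum_sub_distrib, mul_sub, Finset.sum_const, nsmul_eq_mul]
        rw [← mul_assoc (X.card : ℂ), ← sq, inv_mul_cancel_left₀ hXC]
      rw [this]
      exact havg _ fun t ht t' ht' => hη t ht t' ht' w
    | succ j ih =>
      intro w
      rw [hrec (j + 1), hrec j, ← mul_sub]
      simp only [← Finset.sum_sub_distrib]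
      exact havg _ fun t _ t' _ => ih _
  induction j with
  | zero => simp
  | succ j ih =>
    calc ‖H (j + 1) w - H 0 w‖ = ‖(H (j + 1) w - H j w) + (H j w - H 0 w)‖ := by ring_nf
      _ ≤ η + j * η := (norm_add_le _ _).trans (add_le_add (hstep j w) ih)
      _ = _ := by push_cast; ring

/-- A function with absolutely summable Fourier coefficients and a set `X` of almost periods is
almost invariant under any subspace annihilating the large spectrum of `X`. -/
theorem abs_sub_le_of_almost_periods {p n : ℕ} [Fact p.Prime] {X : Finset (Fin n → ZMod p)}
    (hX : X.Nonempty) {D : (Fin n → ZMod p) → ℝ} {c : (Fin n → ZMod p) → ℂ}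
    (hD : ∀ w, (D w : ℂ) = ∑ r, c r * ZMod.stdAddChar (r ⬝ᵥ w)) {K η : ℝ}
    (hc : ∑ r, ‖c r‖ ≤ K) (hη : ∀ t ∈ X, ∀ t' ∈ X, ∀ w, |D (w + t - t') - D w| ≤ η)
    {V : Submodule (ZMod p) (Fin n → ZMod p)}
    (hV : ∀ r : Fin n → ZMod p,
        (1 / 2 : ℝ) * X.card ≤ ‖∑ t ∈ X, (ZMod.stdAddChar (r ⬝ᵥ t) : ℂ)‖ →
        ∀ v ∈ V, r ⬝ᵥ v = 0) (m : ℕ) {v : Fin n → ZMod p} (hv : v ∈ V) :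
    |D v - D 0| ≤ 2 * (m * η) + 2 * (1 / 4) ^ m * K := by
  have hXpos : (0 : ℝ) < X.card := by exact_mod_cast hX.card_pos
  obtain ⟨s, hsdef⟩ : ∃ s : (Fin n → ZMod p) → ℂ, ∀ r, s r =
    ((X.card : ℂ) ^ 2)⁻¹ * ∑ t ∈ X, ∑ t' ∈ X, ZMod.stdAddChar (r ⬝ᵥ (t - t')) := ⟨_, fun _ => rfl⟩
  have hs : ∀ r, ‖s r‖ = ((X.card : ℝ)⁻¹ * ‖∑ t ∈ X, (ZMod.stdAddChar (r ⬝ᵥ t) : ℂ)‖) ^ 2 :=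
      fun r => by
    have : ∑ t ∈ X, ∑ t' ∈ X, (ZMod.stdAddChar (r ⬝ᵥ (t - t')) : ℂ) =
        (∑ t ∈ X, (ZMod.stdAddChar (r ⬝ᵥ t) : ℂ)) *
          (starRingEnd ℂ) (∑ t ∈ X, (ZMod.stdAddChar (r ⬝ᵥ t) : ℂ)) := by
      rw [map_sum, Finset.sum_mul_sum]
      refine Finset.sum_congr rfl fun x _ => Finset.sum_congr rfl fun y _ => ?_
      rw [conj_stdAddChar, dotProduct_sub, sub_eq_add_neg, AddChar.map_add_eq_mul]
    rw [hsdef, this]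
    simp only [norm_mul, norm_inv, norm_pow, Complex.norm_natCast, Complex.norm_conj]
    ring
  obtain ⟨H, hH⟩ : ∃ H : ℕ → (Fin n → ZMod p) → ℂ, ∀ j w, H j w =
    ∑ r, c r * s r ^ j * ZMod.stdAddChar (r ⬝ᵥ w) := ⟨_, fun _ _ => rfl⟩
  have hrec : ∀ j w, H (j + 1) w =
      ((X.card : ℂ) ^ 2)⁻¹ * ∑ t ∈ X, ∑ t' ∈ X, H j (w + t - t') := fun j w => by
    simp only [hH]
    simp_rw [Finset.sum_comm (s := X) (t := Finset.univ)]
    rw [Finset.mul_sum]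
    refine Finset.sum_congr rfl fun r _ => ?_
    simp only [add_sub_assoc, dotProduct_add r w, AddChar.map_add_eq_mul, ← mul_assoc,
      ← Finset.mul_sum]
    rw [pow_succ, hsdef r]
    ring
  have hH0 : ∀ w, H 0 w = D w := fun w => by simp [hH, hD]
  have hmany : ∀ (j : ℕ) w, ‖H j w - D w‖ ≤ j * η := fun j w => by
    rw [← hH0]
    refine norm_iterated_average_sub_le hX hrec (fun t ht t' ht' w => ?_) j w
    rw [hH0, hH0, ← Complex.ofReal_sub, Complex.norm_real]
    exact hη t ht t' ht' w
  have hinvar : ‖H m v - H m 0‖ ≤ 2 * (1 / 4) ^ m * K := by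
    simp only [hH, ← Finset.sum_sub_distrib, ← mul_sub]
    calc _ ≤ ∑ r, 2 * (1 / 4) ^ m * ‖c r‖ := norm_sum_le_of_le _ fun r _ => ?_
      _ ≤ _ := by rw [← Finset.mul_sum]; gcongr
    by_cases hr : (1 / 2 : ℝ) * X.card ≤ ‖∑ t ∈ X, (ZMod.stdAddChar (r ⬝ᵥ t) : ℂ)‖
    · rw [hV r hr v hv, dotProduct_zero, sub_self, mul_zero, norm_zero]
      positivity
    · have h1 : ‖s r‖ ≤ 1 / 4 := by
        rw [hs, show (1 / 4 : ℝ) = (1 / 2) ^ 2 by norm_num]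
        gcongr
        rw [inv_mul_le_iff₀ hXpos]
        linarith
      have h2 : ‖(ZMod.stdAddChar (r ⬝ᵥ v) : ℂ) - ZMod.stdAddChar (r ⬝ᵥ (0 : Fin n → ZMod p))‖
          ≤ 2 := by
        refine (norm_sub_le _ _).trans ?_
        rw [AddChar.norm_apply, AddChar.norm_apply]
        norm_num
      rw [norm_mul, norm_mul, norm_pow]
      calc ‖c r‖ * ‖s r‖ ^ m * _ ≤ ‖c r‖ * (1 / 4) ^ m * 2 := by gcongr
        _ = _ := by ring
  have hfin : ‖(D v : ℂ) - D 0‖ ≤ 2 * (m * η) + 2 * (1 / 4) ^ m * K :=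
    calc ‖(D v : ℂ) - D 0‖ = ‖(H m v - H m 0) + ((H m 0 - D 0) - (H m v - D v))‖ := by ring_nf
      _ ≤ 2 * (1 / 4) ^ m * K + (m * η + m * η) :=
        (norm_add_le _ _).trans (add_le_add hinvar
          ((norm_sub_le _ _).trans (add_le_add (hmany m 0) (hmany m v))))
      _ = _ := by ring
  rwa [← Complex.ofReal_sub, Complex.norm_real] at hfin

theorem one_le_Lg {t : ℝ} (h0 : 0 < t) (h1 : t ≤ 1) : 1 ≤ Lg t := by
  rw [Lg, Real.le_logb_iff_rpow_le one_lt_two (by positivity), Real.rpow_one, le_div_iff₀ h0]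
  linarith

theorem log_two_div_le_Lg {t : ℝ} (h0 : 0 < t) (h1 : t ≤ 1) : Real.log (2 / t) ≤ Lg t := by
  have h2 : 0 ≤ Real.log (2 / t) := Real.log_nonneg ((one_le_div h0).mpr (by linarith))
  rw [Lg, Real.logb]
  exact le_div_self h2 (Real.log_pos one_lt_two) (by linarith [Real.log_two_lt_d9])

/-- Means of diagonal averages over translates of `B` are almost invariant under a subspace of
small codimension. -/
theorem exists_submodule_almost_invariant {p n l : ℕ} [Fact p.Prime] (hl : 1 ≤ l) {ε β : ℝ}
    (hε : 0 < ε) (hε1 : ε ≤ 1) {B : Finset (Fin n → ZMod p)} (hB : B.Nonempty)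
    (hβ : (B.card : ℝ) = β * Fintype.card (Fin n → ZMod p)) (hβ1 : β < 1)
    {f : (Fin l → Fin n → ZMod p) → ℝ} (hf : ∀ x, |f x| ≤ 1) :
    ∃ V : Submodule (ZMod p) (Fin n → ZMod p),
      ((n - Module.finrank (ZMod p) V : ℕ) : ℝ) ≤
        65536 * ε ^ (-2 : ℤ) * (l : ℝ) * Lg β ^ 2 * Lg (ε * β ^ l) ^ 2 ∧
      ∀ v ∈ V, |translateMean B (diagAverage l B f) v -
        translateMean B (diagAverage l B f) 0| ≤ ε := by
  set N : ℝ := (Fintype.card (Fin n → ZMod p) : ℝ) with hN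
  have hNpos : 0 < N := by rw [hN]; exact_mod_cast Fintype.card_pos
  have hBpos : (0 : ℝ) < B.card := by exact_mod_cast hB.card_pos
  have hβpos : 0 < β := by
    rw [hβ] at hBpos
    exact pos_of_mul_pos_left hBpos hNpos.le
  have hlpos : (1 : ℝ) ≤ l := by exact_mod_cast hl
  have hβl : β ^ l ≤ β := pow_le_of_le_one hβpos.le hβ1.le (by omega)
  have ht0 : 0 < ε * β ^ l := by positivity
  have ht1 : ε * β ^ l ≤ ε * β := by gcongr
  have hL1 : 1 ≤ Lg (ε * β ^ l) := one_le_Lg ht0 (ht1.trans (by nlinarith))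
  have hLβ1 : 1 ≤ Lg β := one_le_Lg hβpos hβ1.le
  set L := Lg (ε * β ^ l) with hL
  set Lβ := Lg β with hLβ
  set m : ℕ := ⌈L⌉₊ with hm
  have hmL : L ≤ m := Nat.le_ceil L
  have hm2 : (m : ℝ) ≤ 2 * L := by
    have := Nat.ceil_lt_add_one (by linarith : 0 ≤ L)
    linarith
  have hmpos : (0 : ℝ) < m := by linarith
  have hpow : (1 / 4 : ℝ) ^ m ≤ ε * β / 4 := by
    have h1 : 2 / (ε * β) ≤ 2 ^ m :=
      calc 2 / (ε * β) ≤ 2 / (ε * β ^ l) := by gcongr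
        _ = (2 : ℝ) ^ L := by
          rw [hL, Lg, Real.rpow_logb two_pos (by norm_num) (by positivity)]
        _ ≤ (2 : ℝ) ^ (m : ℝ) := Real.rpow_le_rpow_of_exponent_le one_le_two hmL
        _ = 2 ^ m := Real.rpow_natCast _ _
    have h2 : (1 / 2 : ℝ) ^ m ≤ ε * β / 2 := by
      rw [one_div, inv_pow]
      refine inv_le_of_inv_le₀ (by positivity) ?_
      rwa [inv_div]
    have h3 : ε * β ≤ 1 := by nlinarith
    have h4 : 0 < ε * β := by positivity
    calc (1 / 4 : ℝ) ^ m = ((1 / 2 : ℝ) ^ m) ^ 2 := by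
          rw [← pow_mul, mul_comm, pow_mul]; norm_num
      _ ≤ (ε * β / 2) ^ 2 := by gcongr
      _ ≤ ε * β / 4 := by nlinarith
  set δ : ℝ := ε / (8 * m) with hδ
  have hδpos : 0 < δ := by positivity
  set k : ℕ := ⌈16 * Lβ / δ ^ 2⌉₊ with hk
  have hkδ : 16 * Lβ ≤ k * δ ^ 2 := by
    rw [← div_le_iff₀ (by positivity)]
    exact Nat.le_ceil _
  have hkpos : 0 < k := Nat.ceil_pos.mpr (by positivity)
  have hk1 : (1 : ℝ) ≤ k := by exact_mod_cast hkpos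
  have hδ1 : δ ≤ 1 := by
    rw [hδ, div_le_one (by positivity)]
    linarith
  have hk2 : (k : ℝ) ≤ 8192 * ε ^ (-2 : ℤ) * Lβ * L ^ 2 := by
    have h1 : 1 ≤ 16 * Lβ / δ ^ 2 := by
      rw [le_div_iff₀ (by positivity)]
      nlinarith
    have h2 := Nat.ceil_lt_add_one (by linarith : 0 ≤ 16 * Lβ / δ ^ 2)
    calc (k : ℝ) ≤ 2 * (16 * Lβ / δ ^ 2) := by linarith
      _ = 2048 * ε ^ (-2 : ℤ) * Lβ * (m : ℝ) ^ 2 := by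
        rw [hδ, zpow_neg]
        field_simp
        norm_cast
      _ ≤ 2048 * ε ^ (-2 : ℤ) * Lβ * (2 * L) ^ 2 := by gcongr
      _ = _ := by ring
  have hlog : Real.log (2 / β) ≤ Lβ := log_two_div_le_Lg hβpos hβ1.le
  have hlog2 : Real.log 2 ≤ 1 := by linarith [Real.log_two_lt_d9]
  obtain ⟨X, hXcard, hXper⟩ := exists_almost_periods hB hβ hf hδpos hkpos (by
    rw [show 4 / β = 2 * (2 / β) by ring, Real.log_mul two_ne_zero (by positivity)]
    linarith)
  have hXpos : (0 : ℝ) < X.card := by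
    have : 0 < β ^ (l * k) * N := by positivity
    linarith
  have hX : X.Nonempty := Finset.card_pos.mp (by exact_mod_cast hXpos)
  obtain ⟨V, hVdim, hV⟩ := exists_submodule_annihilating_large_spectrum hX
  obtain ⟨c, hD, hc⟩ := exists_fourier_expansion_translateMean hB
    (abs_diagAverage_le l hB hf)
  refine ⟨V, hVdim.trans ?_, fun v hv => ?_⟩
  · have hlk : 1 ≤ l * k := Nat.mul_pos hl hkpos
    have h1 : N / X.card ≤ (2 / β) ^ (l * k) := by
      rw [div_pow, div_le_div_iff₀ hXpos (by positivity)]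
      calc N * β ^ (l * k) ≤ 2 ^ 1 * X.card := by linarith
        _ ≤ 2 ^ (l * k) * X.card := by gcongr; exact one_le_two
    have h2 : Real.log (N / X.card) ≤ l * k * Lβ := by
      refine (Real.log_le_log (by positivity) h1).trans ?_
      rw [Real.log_pow]
      push_cast
      gcongr
    calc 8 * Real.log (N / X.card) ≤ 8 * (l * k * Lβ) := by gcongr
      _ ≤ 8 * (l * (8192 * ε ^ (-2 : ℤ) * Lβ * L ^ 2) * Lβ) := by gcongr
      _ = _ := by ring
  · refine (abs_sub_le_of_almost_periods hX hD hc hXper hV m hv).trans ?_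
    have h1 : N / B.card = β⁻¹ := by
      rw [hβ]
      field_simp
    rw [← hN, h1]
    calc 2 * (m * (2 * δ)) + 2 * (1 / 4) ^ m * β⁻¹
        ≤ 2 * (m * (2 * δ)) + 2 * (ε * β / 4) * β⁻¹ := by gcongr
      _ = ε := by
        rw [hδ]
        field_simp
        norm_num

theorem sum_mul_circL_prodInd_diag {G : Type*} [AddCommGroup G] [Fintype G] {l : ℕ}
    {B : Finset G} (hB : B.Nonempty) (f : (Fin l → G) → ℝ) (h : G → ℝ) :
    ∑ x, f x * circL l (prodInd l B) (diag l h) x =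
      (B.card : ℝ) ^ l * ∑ z, h z * diagAverage l B f z := by
  have hBpos : (0 : ℝ) < B.card := by exact_mod_cast hB.card_pos
  have hprod : ∀ y : Fin l → G, prodInd l B y =
      if y ∈ Fintype.piFinset (fun _ : Fin l => B) then 1 else 0 := fun y => by
    simp only [prodInd, ind, Finset.prod_ite_zero, Fintype.mem_piFinset]
    simp
  have hcond : ∀ (x y : Fin l → G) (z : G),
      (∀ i, (y + x) i = z) ↔ x = fun i => z - y i := fun x y z => by
    simp only [funext_iff, Pi.add_apply, eq_sub_iff_add_eq']
  have hx : ∀ (y : Fin l → G) (z : G),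
      ∑ x, f x * (if (∀ i, (y + x) i = z) then h z else 0) = h z * f (fun i => z - y i) := by
    intro y z
    simp only [hcond]
    simp [mul_comm]
  calc ∑ x, f x * circL l (prodInd l B) (diag l h) x
      = ∑ y, prodInd l B y * ∑ z, ∑ x, f x * (if (∀ i, (y + x) i = z) then h z else 0) := by
        simp only [circL, diag, Finset.mul_sum]
        rw [Finset.sum_comm]
        refine Finset.sum_congr rfl fun y _ => ?_
        rw [Finset.sum_comm]
        refine Finset.sum_congr rfl fun z _ => Finset.sum_congr rfl fun x _ => ?_
        ring
    _ = ∑ y ∈ Fintype.piFinset (fun _ : Fin l => B), ∑ z, h z * f (fun i => z - y i) := by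
        simp only [hx, hprod, ite_mul, one_mul, zero_mul]
        rw [Finset.sum_ite_mem, Finset.univ_inter]
    _ = ∑ z, h z * ∑ y ∈ Fintype.piFinset (fun _ : Fin l => B), f (fun i => z - y i) := by
        rw [Finset.sum_comm]
        simp only [Finset.mul_sum]
    _ = _ := by
        simp only [diagAverage, Finset.mul_sum]
        refine Finset.sum_congr rfl fun z _ => Finset.sum_congr rfl fun y _ => ?_
        field_simp

theorem sum_ind_mul {G : Type*} [AddCommGroup G] [Fintype G] {B : Finset G} (hB : B.Nonempty)
    (g : G → ℝ) : ∑ z, ind B z * g z = B.card * translateMean B g 0 := by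
  have hBpos : (B.card : ℝ) ≠ 0 := by exact_mod_cast hB.card_pos.ne'
  simp [ind, translateMean, mul_inv_cancel_left₀ hBpos]

theorem sum_convol_ind_mul {G : Type*} [AddCommGroup G] [Fintype G] {B : Finset G}
    (hB : B.Nonempty) (μ g : G → ℝ) :
    ∑ z, convol (ind B) μ z * g z = B.card * ∑ v, μ v * translateMean B g v := by
  have hBpos : (B.card : ℝ) ≠ 0 := by exact_mod_cast hB.card_pos.ne'
  have hshift : ∀ y, ∑ z, μ (z - y) * g z = ∑ v, μ v * g (y + v) := fun y =>
    Fintype.sum_equiv (Equiv.subRight y) _ _ fun z => by simp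
  calc ∑ z, convol (ind B) μ z * g z = ∑ y, ind B y * ∑ z, μ (z - y) * g z := by
        simp only [convol, Finset.sum_mul, Finset.mul_sum, mul_assoc]
        exact Finset.sum_comm
    _ = ∑ y ∈ B, ∑ v, μ v * g (y + v) := by simp [hshift, ind]
    _ = ∑ v, μ v * ∑ y ∈ B, g (y + v) := by
        rw [Finset.sum_comm]
        simp only [Finset.mul_sum]
    _ = _ := by
        simp only [translateMean]
        rw [Finset.mul_sum]
        refine Finset.sum_congr rfl fun v _ => ?_
        field_simp

theorem abs_sum_muV_mul_sub_le {p n : ℕ} [Fact p.Prime]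
    (V : Submodule (ZMod p) (Fin n → ZMod p)) {D : (Fin n → ZMod p) → ℝ} {a ε : ℝ}
    (hD : ∀ v ∈ V, |D v - a| ≤ ε) : |∑ v, muV V v * D v - a| ≤ ε := by
  have hVpos : (0 : ℝ) < Fintype.card V := by exact_mod_cast Fintype.card_pos
  have hsum : ∑ v, muV V v = 1 := by
    simp only [muV]
    rw [← Finset.sum_div, Finset.sum_boole, div_eq_one_iff_eq hVpos.ne', Fintype.card_subtype]
  have hnonneg : ∀ v, 0 ≤ muV V v := fun v => by
    simp only [muV]
    positivity
  calc |∑ v, muV V v * D v - a| = |∑ v, muV V v * (D v - a)| := by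
        simp only [mul_sub, Finset.sum_sub_distrib]
        rw [← Finset.sum_mul, hsum, one_mul]
    _ ≤ ∑ v, muV V v * ε := by
        refine (Finset.abs_sum_le_sum_abs _ _).trans (Finset.sum_le_sum fun v _ => ?_)
        rw [abs_mul, abs_of_nonneg (hnonneg v)]
        by_cases hv : v ∈ V
        · exact mul_le_mul_of_nonneg_left (hD v hv) (hnonneg v)
        · simp [muV, hv]
    _ = ε := by rw [← Finset.sum_mul, hsum, one_mul]

theorem statement7 :
    ∃ C : ℝ, 0 < C ∧
      ∀ (p : ℕ) [Fact p.Prime] (n l : ℕ), 1 ≤ l →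
        ∀ (ε β : ℝ), 0 < ε → ε ≤ 1 →
        ∀ B : Finset (Fin n → ZMod p), B.Nonempty →
          (B.card : ℝ) = β * (Fintype.card (Fin n → ZMod p) : ℝ) → β < 1 →
        ∀ f : (Fin l → (Fin n → ZMod p)) → ℝ, (∀ x, f x ∈ Set.Icc (-1 : ℝ) 1) →
        ∃ V : Submodule (ZMod p) (Fin n → ZMod p),
          ((n - Module.finrank (ZMod p) V : ℕ) : ℝ) ≤
            C * ε ^ (-2 : ℤ) * (l : ℝ) * Lg β ^ 2 * Lg (ε * β ^ l) ^ 2 ∧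
          |(∑ x : Fin l → (Fin n → ZMod p),
              f x * circL l (prodInd l B) (diag l (convol (ind B) (muV V))) x) -
            ∑ x : Fin l → (Fin n → ZMod p),
              f x * circL l (prodInd l B) (diag l (ind B)) x| ≤
          ε * (B.card : ℝ) ^ (l + 1) := by
  refine ⟨65536, by norm_num, ?_⟩
  intro p _ n l hl ε β hε hε1 B hB hβ hβ1 f hf
  obtain ⟨V, hVdim, hV⟩ := exists_submodule_almost_invariant hl hε hε1 hB hβ hβ1
    fun x => abs_le.mpr (hf x)
  refine ⟨V, hVdim, ?_⟩
  rw [sum_mul_circL_prodInd_diag hB, sum_mul_circL_prodInd_diag hB, sum_convol_ind_mul hB,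
    sum_ind_mul hB, ← mul_sub, ← mul_sub, ← mul_assoc, ← pow_succ, abs_mul,
    abs_of_nonneg (by positivity), mul_comm ε]
  exact mul_le_mul_of_nonneg_left (abs_sum_muV_mul_sub_le V hV) (by positivity)
end
end

section
/- Let r ≥ 1 and k₁,…,k_r ≥ 2 be integers with K = k₁⋯k_r even (equivalently, at least one k_j is even). Then for every function f : G → ℝ one has E_{k₁,…,k_r}(f) ≥ 0. -/
open scoped BigOperators

attribute [local instance] Classical.propDecidable

noncomputable section

/-- The generalized energy
`E_{k₁,…,k_r}(f) = Σ_{x₁∈G^{k₁}} ⋯ Σ_{x_r∈G^{k_r}} ∏_{ω∈B} f(x₁^{(ω₁)} + ⋯ + x_r^{(ω_r)})`,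
where `B = [k₁]×…×[k_r]`. -/
def genEnergy (G : Type*) [AddCommGroup G] [Fintype G] {r : ℕ} (k : Fin r → ℕ)
    (f : G → ℝ) : ℝ :=
  ∑ x : (j : Fin r) → Fin (k j) → G, ∏ ω : (j : Fin r) → Fin (k j), f (∑ j, x j (ω j))

/-- The multi-scalar product
`⟨f^ω⟩ = Σ_{x₁∈G^{k₁}} ⋯ Σ_{x_r∈G^{k_r}} ∏_{ω∈B} f^ω(x₁^{(ω₁)} + ⋯ + x_r^{(ω_r)})`. -/
def genProd (G : Type*) [AddCommGroup G] [Fintype G] {r : ℕ} (k : Fin r → ℕ)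
    (F : ((j : Fin r) → Fin (k j)) → G → ℝ) : ℝ :=
  ∑ x : (j : Fin r) → Fin (k j) → G, ∏ ω : (j : Fin r) → Fin (k j), F ω (∑ j, x j (ω j))

/-- Separating the coordinate `j₀` writes the energy as a sum of `k j₀`-th powers. -/
theorem genEnergy_eq_sum_pow {G : Type*} [AddCommGroup G] [Fintype G] {r : ℕ} (k : Fin r → ℕ)
    (f : G → ℝ) (j₀ : Fin r) :
    genEnergy G k f = ∑ x : (j : {j // j ≠ j₀}) → Fin (k j) → G,
      (∑ y : G, ∏ ω : (j : {j // j ≠ j₀}) → Fin (k j), f (y + ∑ j, x j (ω j))) ^ k j₀ := by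
  unfold genEnergy
  rw [← (Equiv.piSplitAt j₀ fun j ↦ Fin (k j) → G).symm.sum_comp, Fintype.sum_prod_type_right]
  refine Fintype.sum_congr _ _ fun x ↦ ?_
  rw [Fintype.sum_pow]
  refine Fintype.sum_congr _ _ fun y ↦ ?_
  rw [← (Equiv.piSplitAt j₀ fun j ↦ Fin (k j)).symm.prod_comp, Fintype.prod_prod_type]
  refine Fintype.prod_congr _ _ fun i ↦ Fintype.prod_congr _ _ fun ω ↦ ?_
  rw [Fintype.sum_eq_add_sum_subtype_ne _ j₀]
  congr 2
  · simp [Equiv.piSplitAt]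
  · refine Fintype.sum_congr _ _ fun j ↦ ?_
    simp [Equiv.piSplitAt, j.2]

theorem statement12 {G : Type*} [AddCommGroup G] [Fintype G]
    (r : ℕ) (hr : 1 ≤ r) (k : Fin r → ℕ) (hk : ∀ j, 2 ≤ k j)
    (hK : Even (∏ j, k j)) (f : G → ℝ) :
    0 ≤ genEnergy G k f := by
  obtain ⟨j₀, -, hj₀⟩ := (Nat.prime_two.prime.dvd_finsetProd_iff _).1 hK.two_dvd
  rw [genEnergy_eq_sum_pow k f j₀]
  exact Finset.sum_nonneg fun _ _ ↦ (even_iff_two_dvd.2 hj₀).pow_nonneg _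
end
end

section
/- Let r ≥ 2 be an integer, k₁,…,k_r ≥ 2 be even integers, K = k₁⋯k_r, B = [k₁]×…×[k_r], and let (f^ω)_{ω∈B} be any family of functions f^ω : G → ℝ. Then |⟨f^ω⟩_{E_{k₁,…,k_r}}| ≤ ∏_{ω∈B} E_{k₁,…,k_r}(f^ω)^{1/K}. -/
open scoped BigOperators

attribute [local instance] Classical.propDecidable

noncomputable section

/-- Generalized Hölder inequality for finitely many functions, with equal exponents. -/
theorem abs_sum_prod_pow_le {α ι : Type*} [Fintype α] [Fintype ι] [Nonempty ι]
    (A : ι → α → ℝ) :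
    |∑ x, ∏ i, A i x| ^ Fintype.card ι ≤ ∏ i, ∑ x, |A i x| ^ Fintype.card ι := by
  set n := Fintype.card ι with hn
  have hn0 : n ≠ 0 := Fintype.card_ne_zero
  have hnR : (n : ℝ) ≠ 0 := Nat.cast_ne_zero.2 hn0
  have hT (i : ι) : 0 ≤ ∑ x, |A i x| ^ n := Finset.sum_nonneg fun x _ => by positivity
  by_cases h : ∃ i, ∑ x, |A i x| ^ n = 0
  · obtain ⟨i, hi⟩ := h
    have hz (x : α) : A i x = 0 := by
      have := (Finset.sum_eq_zero_iff_of_nonneg fun x _ => by positivity).1 hi x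
        (Finset.mem_univ x)
      simpa [hn0] using this
    have : ∑ x, ∏ i, A i x = 0 :=
      Finset.sum_eq_zero fun x _ => Finset.prod_eq_zero (Finset.mem_univ i) (hz x)
    rw [this, abs_zero, zero_pow hn0]
    exact Finset.prod_nonneg fun i _ => hT i
  push Not at h
  have hpos (i : ι) : 0 < ∑ x, |A i x| ^ n := lt_of_le_of_ne (hT i) (h i).symm
  set t : ι → ℝ := fun i => (∑ x, |A i x| ^ n) ^ ((n : ℝ)⁻¹) with ht
  have htpos (i : ι) : 0 < t i := Real.rpow_pos_of_pos (hpos i) _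
  have htn (i : ι) : t i ^ n = ∑ x, |A i x| ^ n := Real.rpow_inv_natCast_pow (hT i) hn0
  have amgm (x : α) : ∏ i, (|A i x| / t i) ≤ ∑ i, (n : ℝ)⁻¹ * (|A i x| / t i) ^ n := by
    have := Real.geom_mean_le_arith_mean_weighted Finset.univ (fun _ : ι => (n : ℝ)⁻¹)
      (fun i => (|A i x| / t i) ^ n) (fun _ _ => by positivity)
      (by simp [← hn, hnR]) (fun i _ => by have := htpos i; positivity)
    refine le_trans (le_of_eq (Finset.prod_congr rfl fun i _ => ?_)) this
    exact (Real.pow_rpow_inv_natCast (by have := htpos i; positivity) hn0).symm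
  have key : ∑ x, ∏ i, (|A i x| / t i) ≤ 1 := by
    refine (Finset.sum_le_sum fun x _ => amgm x).trans (le_of_eq ?_)
    rw [Finset.sum_comm]
    have (i : ι) : ∑ x, (n : ℝ)⁻¹ * (|A i x| / t i) ^ n = (n : ℝ)⁻¹ := by
      simp_rw [div_pow, htn]
      rw [← Finset.mul_sum, ← Finset.sum_div, div_self (h i), mul_one]
    simp [this, ← hn, hnR]
  have hprod : 0 < ∏ i, t i := Finset.prod_pos fun i _ => htpos i
  have hle : |∑ x, ∏ i, A i x| ≤ ∏ i, t i := by
    simp_rw [Finset.prod_div_distrib] at key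
    rw [← Finset.sum_div, div_le_one hprod] at key
    refine (Finset.abs_sum_le_sum_abs _ _).trans ?_
    simpa [Finset.abs_prod] using key
  calc _ ≤ (∏ i, t i) ^ n := pow_le_pow_left₀ (abs_nonneg _) hle n
    _ = _ := by rw [← Finset.prod_pow]; simp_rw [htn]

/-- Resampling one coordinate `j` in a product over all families repeats the product
`Fintype.card (β j)` times. -/
@[to_additive]
theorem Fintype.prod_prod_update {ι M : Type*} [Fintype ι] [DecidableEq ι] {β : ι → Type*}
    [∀ i, Fintype (β i)] [CommMonoid M] (j : ι) (g : (∀ i, β i) → M) :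
    ∏ x, ∏ y : β j, g (Function.update x j y) = (∏ x, g x) ^ Fintype.card (β j) := by
  have hinv : Function.Involutive
      (fun p : (∀ i, β i) × β j => (Function.update p.1 j p.2, p.1 j)) := fun p => by simp
  calc ∏ x, ∏ y : β j, g (Function.update x j y)
      = ∏ p : (∀ i, β i) × β j, g (Function.update p.1 j p.2) :=
        (Fintype.prod_prod_type' fun x y => g (Function.update x j y)).symm
    _ = ∏ p : (∀ i, β i) × β j, g p.1 :=
        Fintype.prod_equiv hinv.toPerm _ _ fun p => rfl
    _ = _ := by
        rw [Fintype.prod_prod_type' fun x _ => g x]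
        simp [Finset.prod_pow]

section

variable {G : Type*} [AddCommGroup G] [Fintype G] {r : ℕ} {k : Fin r → ℕ}

/-- The inner sum over a single variable `x j i`, the other blocks being fixed; it does not depend
on the block `x j`. -/
def innerSum (F : ((j : Fin r) → Fin (k j)) → G → ℝ) (j : Fin r) (i : Fin (k j))
    (x : (l : Fin r) → Fin (k l) → G) : ℝ :=
  ∑ g : G, ∏ ω with ω j = i, F ω (∑ l, Function.update x j (fun _ => g) l (ω l))

theorem card_mul_genProd (F : ((j : Fin r) → Fin (k j)) → G → ℝ) (j : Fin r) :
    (Fintype.card (Fin (k j) → G) : ℝ) * genProd G k F = ∑ x, ∏ i, innerSum F j i x := by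
  rw [genProd, ← nsmul_eq_mul,
    ← Fintype.sum_sum_update (β := fun l : Fin r => Fin (k l) → G) j]
  refine Finset.sum_congr rfl fun x _ => ?_
  simp only [innerSum]
  rw [Finset.prod_univ_sum, Fintype.piFinset_univ]
  refine Finset.sum_congr rfl fun y _ => ?_
  rw [← Finset.prod_fiberwise Finset.univ (fun ω : (l : Fin r) → Fin (k l) => ω j)]
  refine Finset.prod_congr rfl fun i _ => Finset.prod_congr rfl fun ω hω => ?_
  congr 1
  refine Finset.sum_congr rfl fun l _ => ?_
  have hω : ω j = i := by simpa using hω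
  by_cases hl : l = j
  · subst hl
    simp [hω]
  · simp [Function.update_of_ne hl]

theorem innerSum_update (F : ((j : Fin r) → Fin (k j)) → G → ℝ) (j : Fin r) (i i' : Fin (k j))
    (x : (l : Fin r) → Fin (k l) → G) :
    innerSum (fun ω => F (Function.update ω j i)) j i' x = innerSum F j i x := by
  refine Finset.sum_congr rfl fun g _ => ?_
  refine Finset.prod_nbij' (fun ω => Function.update ω j i) (fun ω => Function.update ω j i')
    (by simp) (by simp) (fun ω hω => ?_) (fun ω hω => ?_) (fun ω hω => ?_)
  · have hω : ω j = i' := by simpa using hω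
    simp [← hω]
  · have hω : ω j = i := by simpa using hω
    simp [← hω]
  · congr 1
    refine Finset.sum_congr rfl fun l _ => ?_
    by_cases hl : l = j
    · subst hl
      simp
    · simp [Function.update_of_ne hl]

theorem card_mul_genProd_update (F : ((j : Fin r) → Fin (k j)) → G → ℝ) (j : Fin r)
    (i : Fin (k j)) :
    (Fintype.card (Fin (k j) → G) : ℝ) * genProd G k (fun ω => F (Function.update ω j i)) =
      ∑ x, innerSum F j i x ^ k j := by
  rw [card_mul_genProd _ j]
  simp [innerSum_update]

theorem genProd_update_nonneg (F : ((j : Fin r) → Fin (k j)) → G → ℝ) (j : Fin r)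
    (hj : Even (k j)) (i : Fin (k j)) :
    0 ≤ genProd G k (fun ω => F (Function.update ω j i)) := by
  have hc : (0 : ℝ) < Fintype.card (Fin (k j) → G) := Nat.cast_pos.2 Fintype.card_pos
  refine (mul_nonneg_iff_of_pos_left hc).1 ?_
  rw [card_mul_genProd_update]
  exact Finset.sum_nonneg fun x _ => hj.pow_nonneg _

theorem abs_genProd_pow_le (F : ((j : Fin r) → Fin (k j)) → G → ℝ) (j : Fin r)
    (hj : Even (k j)) (h0 : k j ≠ 0) :
    |genProd G k F| ^ k j ≤ ∏ i, |genProd G k (fun ω => F (Function.update ω j i))| := by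
  have : Nonempty (Fin (k j)) := ⟨⟨0, Nat.pos_of_ne_zero h0⟩⟩
  have hc : (0 : ℝ) < Fintype.card (Fin (k j) → G) := Nat.cast_pos.2 Fintype.card_pos
  have h := abs_sum_prod_pow_le (innerSum F j)
  simp only [Fintype.card_fin, hj.pow_abs, ← card_mul_genProd_update, ← card_mul_genProd,
    Finset.prod_mul_distrib, Finset.prod_const, Finset.card_univ] at h
  rw [mul_pow] at h
  simp_rw [abs_of_nonneg (genProd_update_nonneg F j hj _), hj.pow_abs]
  exact le_of_mul_le_mul_left h (pow_pos hc _)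

theorem abs_genProd_pow_card_le (hk : ∀ j, k j ≠ 0) (hke : ∀ j, Even (k j))
    (F : ((j : Fin r) → Fin (k j)) → G → ℝ) (s : Finset (Fin r)) :
    |genProd G k F| ^ (∏ j, k j) ≤ ∏ η, |genProd G k (fun ω => F (s.piecewise η ω))| := by
  induction s using Finset.induction_on with
  | empty => simp
  | insert j s hjs ih =>
    refine ih.trans ?_
    refine le_of_pow_le_pow_left₀ (hk j) (Finset.prod_nonneg fun _ _ => abs_nonneg _) ?_
    rw [← Finset.prod_pow]
    have hcard := Fintype.prod_prod_update j
      (fun η => |genProd G k (fun ω => F ((insert j s).piecewise η ω))|)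
    rw [Fintype.card_fin] at hcard
    rw [← hcard]
    refine Finset.prod_le_prod (fun _ _ => by positivity) fun η _ => ?_
    refine (abs_genProd_pow_le _ j (hke j) (hk j)).trans (le_of_eq ?_)
    refine Finset.prod_congr rfl fun i _ => ?_
    congr 3 with ω : 1
    congr 1
    ext l : 1
    by_cases hl : l = j
    · subst hl
      simp [hjs]
    · by_cases hs : l ∈ s <;> simp [hl, hs]

theorem genEnergy_eq_genProd (f : G → ℝ) : genEnergy G k f = genProd G k (fun _ => f) := rfl

theorem genEnergy_nonneg (j : Fin r) (hj : Even (k j)) (h0 : k j ≠ 0) (f : G → ℝ) :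
    0 ≤ genEnergy G k f :=
  genProd_update_nonneg (fun _ => f) j hj ⟨0, Nat.pos_of_ne_zero h0⟩

end

theorem statement14 {G : Type*} [AddCommGroup G] [Fintype G]
    (r : ℕ) (hr : 2 ≤ r) (k : Fin r → ℕ) (hk : ∀ j, 2 ≤ k j) (hke : ∀ j, Even (k j))
    (F : ((j : Fin r) → Fin (k j)) → G → ℝ) :
    |genProd G k F| ≤
      ∏ ω : (j : Fin r) → Fin (k j), genEnergy G k (F ω) ^ (((∏ j, k j : ℕ) : ℝ)⁻¹) := by
  have hk0 (j : Fin r) : k j ≠ 0 := by have := hk j; omega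
  have hK : (0 : ℝ) < (∏ j, k j : ℕ) :=
    Nat.cast_pos.2 (Finset.prod_pos fun j _ => Nat.pos_of_ne_zero (hk0 j))
  have hE (f : G → ℝ) : 0 ≤ genEnergy G k f :=
    genEnergy_nonneg ⟨0, by omega⟩ (hke _) (hk0 _) f
  have h := abs_genProd_pow_card_le hk0 hke F Finset.univ
  simp only [Finset.piecewise_univ, ← genEnergy_eq_genProd, abs_of_nonneg (hE _)] at h
  rw [Real.finsetProd_rpow _ _ fun ω _ => hE (F ω)]
  exact (Real.le_rpow_inv_iff_of_pos (abs_nonneg _) (Finset.prod_nonneg fun ω _ => hE (F ω))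
    hK).2 (by rwa [Real.rpow_natCast])
end
end

section
/- Let r, t ≥ 2 be integers with r ≤ t, let k₁,…,k_r ≥ 2 and m₁,…,m_t ≥ 2 all be even integers with k_j ≤ m_j for every j ∈ [r], and set K = k₁⋯k_r, M = m₁⋯m_t. Then for every function f : G → ℝ one has ( N^{-(k₁+⋯+k_r)} E_{k₁,…,k_r}(f) )^{1/K} ≤ ( N^{-(m₁+⋯+m_t)} E_{m₁,…,m_t}(f) )^{1/M}. -/
open scoped BigOperators

attribute [local instance] Classical.propDecidable

noncomputable section

section Moments

variable {G : Type*} [AddCommGroup G] [Fintype G]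

/-- The sum over `y` of the product of the values of `f` at the box of side points `x`,
translated by `y`. -/
def boxSum {n : ℕ} (k : Fin n → ℕ) (f : G → ℝ) (x : (i : Fin n) → Fin (k i) → G) : ℝ :=
  ∑ y : G, ∏ ω : (i : Fin n) → Fin (k i), f (y + ∑ i, x i (ω i))

/-- The `a`-th moment of the normalized box sums. -/
def boxMoment (G : Type*) [AddCommGroup G] [Fintype G] {n : ℕ} (k : Fin n → ℕ) (a : ℕ)
    (f : G → ℝ) : ℝ :=
  ∑ x : (i : Fin n) → Fin (k i) → G,
    ((Fintype.card G : ℝ) ^ (∑ j, k j))⁻¹ * ((Fintype.card G : ℝ)⁻¹ * boxSum k f x) ^ a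

/-- The generalized energy divided by the number of its summands. -/
def meanEnergy (G : Type*) [AddCommGroup G] [Fintype G] {r : ℕ} (k : Fin r → ℕ)
    (f : G → ℝ) : ℝ :=
  ((Fintype.card G : ℝ) ^ (∑ j, k j))⁻¹ * genEnergy G k f

theorem genEnergy_eq_sum_boxSum_pow {n : ℕ} (k : Fin (n + 1) → ℕ) (p : Fin (n + 1))
    (f : G → ℝ) :
    genEnergy G k f =
      ∑ x : (i : Fin n) → Fin (k (p.succAbove i)) → G,
        boxSum (fun i => k (p.succAbove i)) f x ^ k p := by
  unfold genEnergy boxSum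
  rw [← (Fin.insertNthEquiv (fun i => Fin (k i) → G) p).sum_comp, Fintype.sum_prod_type_right]
  refine Finset.sum_congr rfl fun x _ => ?_
  have hpow := Finset.prod_univ_sum (ι := Fin (k p)) (fun _ => (Finset.univ : Finset G))
    (fun _ y => ∏ ω : (i : Fin n) → Fin (k (p.succAbove i)), f (y + ∑ i, x i (ω i)))
  rw [Finset.prod_const, Finset.card_univ, Fintype.card_fin] at hpow
  rw [hpow, Fintype.piFinset_univ]
  refine Finset.sum_congr rfl fun y _ => ?_
  rw [← (Fin.insertNthEquiv (fun i => Fin (k i)) p).prod_comp, Fintype.prod_prod_type]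
  refine Finset.prod_congr rfl fun a _ => Finset.prod_congr rfl fun ω _ => ?_
  rw [Fin.sum_univ_succAbove _ p]
  simp [Fin.insertNthEquiv]

theorem meanEnergy_eq_boxMoment {n : ℕ} (k : Fin (n + 1) → ℕ) (p : Fin (n + 1)) (f : G → ℝ) :
    meanEnergy G k f = boxMoment G (fun i => k (p.succAbove i)) (k p) f := by
  unfold meanEnergy boxMoment
  rw [genEnergy_eq_sum_boxSum_pow k p, Finset.mul_sum, Fin.sum_univ_succAbove _ p]
  refine Finset.sum_congr rfl fun x _ => ?_
  rw [pow_add, mul_inv, mul_pow, inv_pow]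
  ring

theorem sum_boxWeight {n : ℕ} (k : Fin n → ℕ) :
    ∑ _x : (i : Fin n) → Fin (k i) → G, ((Fintype.card G : ℝ) ^ (∑ j, k j))⁻¹ = 1 := by
  have hN : (Fintype.card G : ℝ) ≠ 0 := by exact_mod_cast Fintype.card_ne_zero
  rw [Finset.sum_const, Finset.card_univ, Fintype.card_pi, nsmul_eq_mul]
  simp only [Fintype.card_fun, Fintype.card_fin, Finset.prod_pow_eq_pow_sum]
  push_cast
  exact mul_inv_cancel₀ (pow_ne_zero _ hN)

theorem boxMoment_nonneg {n : ℕ} (k : Fin n → ℕ) {a : ℕ} (ha : Even a) (f : G → ℝ) :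
    0 ≤ boxMoment G k a f :=
  Finset.sum_nonneg fun _ _ => mul_nonneg (by positivity) (ha.pow_nonneg _)

theorem boxMoment_rpow_le {n : ℕ} (k : Fin n → ℕ) {a b : ℕ} (ha : Even a) (hb : Even b)
    (ha0 : 0 < a) (hab : a ≤ b) (f : G → ℝ) :
    boxMoment G k a f ^ ((b : ℝ) / a) ≤ boxMoment G k b f := by
  have ha' : (0 : ℝ) < a := by exact_mod_cast ha0
  have hp : (1 : ℝ) ≤ (b : ℝ) / a := by
    rw [one_le_div ha']
    exact_mod_cast hab
  refine (Real.rpow_arith_mean_le_arith_mean_rpow Finset.univ _ _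
    (fun _ _ => by positivity) (sum_boxWeight k) (fun x _ => ha.pow_nonneg _) hp).trans_eq ?_
  refine Finset.sum_congr rfl fun x _ => ?_
  rw [← ha.pow_abs, ← hb.pow_abs, ← Real.rpow_natCast _ a, ← Real.rpow_mul (abs_nonneg _),
    mul_div_cancel₀ _ ha'.ne', Real.rpow_natCast]

theorem sum_boxSum {n : ℕ} (i₀ : Fin n) (k : Fin n → ℕ) (f : G → ℝ) :
    ∑ x, boxSum k f x = Fintype.card G * genEnergy G k f := by
  unfold boxSum genEnergy
  rw [Finset.sum_comm, ← nsmul_eq_mul, ← Finset.card_univ, ← Finset.sum_const]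
  refine Finset.sum_congr rfl fun y _ => ?_
  refine Fintype.sum_equiv
    (Equiv.addRight (fun (i : Fin n) (_ : Fin (k i)) => if i = i₀ then y else 0)) _ _ fun x =>
      Finset.prod_congr rfl fun ω _ => ?_
  simp only [Equiv.coe_addRight, Pi.add_apply, Finset.sum_add_distrib, Finset.sum_ite_eq',
    Finset.mem_univ, if_true]
  rw [add_comm]

theorem meanEnergy_pow_le_boxMoment {n : ℕ} (i₀ : Fin n) (k : Fin n → ℕ) {a : ℕ} (ha : Even a)
    (f : G → ℝ) : meanEnergy G k f ^ a ≤ boxMoment G k a f := by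
  have hN : (Fintype.card G : ℝ) ≠ 0 := by exact_mod_cast Fintype.card_ne_zero
  refine le_of_eq_of_le ?_ (Real.pow_arith_mean_le_arith_mean_pow_of_even Finset.univ _ _
    (fun _ _ => by positivity) (sum_boxWeight k) ha)
  congr 1
  rw [← Finset.mul_sum, ← Finset.mul_sum, sum_boxSum i₀, inv_mul_cancel_left₀ hN, meanEnergy]

theorem meanEnergy_nonneg {r : ℕ} (i₀ : Fin r) (k : Fin r → ℕ) (hk : ∀ i, Even (k i))
    (f : G → ℝ) : 0 ≤ meanEnergy G k f := by
  obtain _ | n := r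
  · exact i₀.elim0
  · rw [meanEnergy_eq_boxMoment k i₀]
    exact boxMoment_nonneg _ (hk i₀) f

/-- The mean energy raised to the reciprocal of the number of factors in its products. -/
def energyNorm (G : Type*) [AddCommGroup G] [Fintype G] {r : ℕ} (k : Fin r → ℕ)
    (f : G → ℝ) : ℝ :=
  meanEnergy G k f ^ (((∏ j, k j : ℕ) : ℝ)⁻¹)

theorem energyNorm_le_update {r : ℕ} (k : Fin r → ℕ) (p : Fin r) {b : ℕ}
    (hk : ∀ i, Even (k i)) (hb : Even b) (hp : 0 < k p) (hpb : k p ≤ b) (f : G → ℝ) :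
    energyNorm G k f ≤ energyNorm G (Function.update k p b) f := by
  obtain _ | n := r
  · exact p.elim0
  have ha' : (k p : ℝ) ≠ 0 := by exact_mod_cast hp.ne'
  have hb' : (b : ℝ) ≠ 0 := by exact_mod_cast (hp.trans_le hpb).ne'
  unfold energyNorm
  rw [meanEnergy_eq_boxMoment k p, meanEnergy_eq_boxMoment (Function.update k p b) p,
    Fin.prod_univ_succAbove _ p, Fin.prod_univ_succAbove (Function.update k p b) p]
  simp only [Function.update_self, Function.update_of_ne (Fin.succAbove_ne p _)]
  have h0 := boxMoment_nonneg (fun i => k (p.succAbove i)) (hk p) f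
  have h := Real.rpow_le_rpow (Real.rpow_nonneg h0 _)
    (boxMoment_rpow_le (fun i => k (p.succAbove i)) (hk p) hb hp hpb f)
    (z := ((b * ∏ i, k (p.succAbove i) : ℕ) : ℝ)⁻¹) (by positivity)
  rw [← Real.rpow_mul h0] at h
  refine le_of_eq_of_le ?_ h
  congr 1
  push_cast
  rw [mul_inv, mul_inv]
  field_simp

theorem energyNorm_mono {r : ℕ} (k m : Fin r → ℕ) (hk0 : ∀ i, 0 < k i)
    (hk : ∀ i, Even (k i)) (hm : ∀ i, Even (m i)) (hkm : ∀ i, k i ≤ m i) (f : G → ℝ) :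
    energyNorm G k f ≤ energyNorm G m f := by
  suffices h : ∀ s : Finset (Fin r), energyNorm G k f ≤ energyNorm G (s.piecewise m k) f by
    simpa using h Finset.univ
  intro s
  induction s using Finset.induction_on with
  | empty => simp
  | insert p s hps ih =>
    rw [Finset.piecewise_insert]
    have hp : s.piecewise m k p = k p := Finset.piecewise_eq_of_notMem _ _ _ hps
    refine ih.trans (energyNorm_le_update _ p (fun i => ?_) (hm p) ?_ ?_ f)
    · exact Finset.piecewise_cases s m k Even (hm i) (hk i)
    · exact hp ▸ hk0 p
    · exact hp ▸ hkm p

theorem energyNorm_castSucc_le {n : ℕ} (i₀ : Fin n) (m : Fin (n + 1) → ℕ)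
    (hm0 : ∀ i, 0 < m i) (hm : ∀ i, Even (m i)) (f : G → ℝ) :
    energyNorm G (fun i : Fin n => m i.castSucc) f ≤ energyNorm G m f := by
  have ha' : (m (Fin.last n) : ℝ) ≠ 0 := by exact_mod_cast (hm0 _).ne'
  unfold energyNorm
  have h0 := meanEnergy_nonneg i₀ (fun i => m i.castSucc) (fun i => hm _) f
  rw [meanEnergy_eq_boxMoment m (Fin.last n), Fin.prod_univ_castSucc]
  simp only [Fin.succAbove_last]
  have h := Real.rpow_le_rpow (pow_nonneg h0 _)
    (meanEnergy_pow_le_boxMoment i₀ (fun i => m i.castSucc) (hm (Fin.last n)) f)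
    (z := (((∏ i : Fin n, m i.castSucc) * m (Fin.last n) : ℕ) : ℝ)⁻¹) (by positivity)
  rw [← Real.rpow_natCast, ← Real.rpow_mul h0] at h
  refine le_of_eq_of_le ?_ h
  congr 1
  push_cast
  rw [mul_inv]
  field_simp

theorem energyNorm_castLE_le {r t : ℕ} (i₀ : Fin r) (hrt : r ≤ t) (m : Fin t → ℕ)
    (hm0 : ∀ i, 0 < m i) (hm : ∀ i, Even (m i)) (f : G → ℝ) :
    energyNorm G (fun i : Fin r => m (Fin.castLE hrt i)) f ≤ energyNorm G m f := by
  induction t, hrt using Nat.le_induction with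
  | base => exact le_rfl
  | succ t hrt ih =>
    exact (ih (fun i => m i.castSucc) (fun i => hm0 _) (fun i => hm _)).trans
      (energyNorm_castSucc_le (Fin.castLE hrt i₀) m hm0 hm f)

end Moments

theorem statement16 {G : Type*} [AddCommGroup G] [Fintype G]
    (r t : ℕ) (hr : 2 ≤ r) (ht : 2 ≤ t) (hrt : r ≤ t)
    (k : Fin r → ℕ) (m : Fin t → ℕ)
    (hk2 : ∀ j, 2 ≤ k j) (hm2 : ∀ j, 2 ≤ m j)
    (hke : ∀ j, Even (k j)) (hme : ∀ j, Even (m j))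
    (hkm : ∀ j : Fin r, k j ≤ m (Fin.castLE hrt j))
    (f : G → ℝ) :
    (((Fintype.card G : ℝ) ^ (∑ j, k j))⁻¹ * genEnergy G k f) ^ (((∏ j, k j : ℕ) : ℝ)⁻¹) ≤
      (((Fintype.card G : ℝ) ^ (∑ j, m j))⁻¹ * genEnergy G m f) ^
        (((∏ j, m j : ℕ) : ℝ)⁻¹) := by
  exact (energyNorm_mono k (fun j => m (Fin.castLE hrt j)) (fun j => two_pos.trans_le (hk2 j))
    hke (fun j => hme _) hkm f).trans
    (energyNorm_castLE_le ⟨0, two_pos.trans_le hr⟩ hrt m (fun j => two_pos.trans_le (hm2 j)) hme f)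
end
end

section
/- For every function f : G → ℝ and all integers k, l ≥ 1 one has the duality E^k_l(f) = E^l_k(f), i.e. Σ_{(x_1,…,x_l)∈G^l} ( Σ_{z∈G} f(z+x_1)⋯f(z+x_l) )^k = Σ_{(y_1,…,y_k)∈G^k} ( Σ_{z∈G} f(z+y_1)⋯f(z+y_k) )^l. -/
open scoped BigOperators

attribute [local instance] Classical.propDecidable

noncomputable section

/-- The expansion of the higher energy as a double sum over `G^l` and `G^k`. -/
theorem energy_eq_sum_sum_prod (G : Type*) [AddCommGroup G] [Fintype G] (k l : ℕ) (f : G → ℝ) :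
    energy G k l f =
      ∑ x : Fin l → G, ∑ z : Fin k → G, ∏ j : Fin k, ∏ i : Fin l, f (z j + x i) := by
  unfold energy conv
  refine Finset.sum_congr rfl fun x _ => ?_
  rw [Fintype.sum_pow]

theorem statement18 {G : Type*} [AddCommGroup G] [Fintype G]
    (k l : ℕ) (hk : 1 ≤ k) (hl : 1 ≤ l) (f : G → ℝ) :
    energy G k l f = energy G l k f := by
  rw [energy_eq_sum_sum_prod, energy_eq_sum_sum_prod, Finset.sum_comm]
  refine Finset.sum_congr rfl fun z _ => Finset.sum_congr rfl fun x _ => ?_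
  rw [Finset.prod_comm]
  simp only [add_comm]
end
end
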